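/- arXiv:math/0502211 — 2 statements merged into one kernel-verified Lean document; each statement's English description precedes it below -/
import Mathlib

section
/- Let A and D be separable C*-algebras with D unital, strongly self-absorbing and K₁-injective. Then there is a sequence (sₙ) of contractions in A ⊗ D ⊗ D such that for all a ∈ A and d ∈ D: (i) ‖[sₙ, a ⊗ 1_D ⊗ 1_D]‖ → 0; (ii) ‖sₙ*(a ⊗ 1_D ⊗ d)sₙ − a ⊗ d ⊗ 1_D‖ → 0; (iii) ‖sₙ*sₙ(a ⊗ 1_D ⊗ 1_D) − a ⊗ 1_D ⊗ 1_D‖ → 0; (iv) sₙ + 1 − (sₙsₙ*)^{1/2} is a unitary in the unitization (A ⊗ D ⊗ D)⁺, where 1 denotes the unit of (A ⊗ D ⊗ D)⁺. -/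
open scoped MultiplierAlgebra TensorProduct
open Filter Topology

noncomputable section

universe u v w x

/-- Approximate unitary equivalence of two maps `φ ψ : A → B`, witnessed by a sequence of
unitaries in the multiplier algebra `𝓜(ℂ, B)` (in which `B` embeds canonically). -/
def ApproxUnitaryEquiv {A : Type u} {B : Type v} [NonUnitalCStarAlgebra B]
    (φ ψ : A → B) : Prop :=
  ∃ v : ℕ → 𝓜(ℂ, B), (∀ n, v n ∈ unitary 𝓜(ℂ, B)) ∧
    ∀ a : A, Tendsto
      (fun n => ‖star (v n) * (φ a : 𝓜(ℂ, B)) * v n - (ψ a : 𝓜(ℂ, B))‖)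
      atTop (𝓝 (0 : ℝ))

/-- Data exhibiting `T` as a C*-tensor product of `A` and `B`: a bilinear, multiplicative,
star-preserving, cross-normed map `A × B → T` with dense span. -/
structure CStarTensor (A : Type u) (B : Type v) (T : Type w) [NonUnitalCStarAlgebra A]
    [NonUnitalCStarAlgebra B] [NonUnitalCStarAlgebra T] where
  tmul : A → B → T
  add_left : ∀ a a' b, tmul (a + a') b = tmul a b + tmul a' b
  add_right : ∀ a b b', tmul a (b + b') = tmul a b + tmul a b'
  smul_left : ∀ (c : ℂ) a b, tmul (c • a) b = c • tmul a b
  smul_right : ∀ (c : ℂ) a b, tmul a (c • b) = c • tmul a b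
  mul_tmul : ∀ a a' b b', tmul a b * tmul a' b' = tmul (a * a') (b * b')
  star_tmul : ∀ a b, star (tmul a b) = tmul (star a) (star b)
  norm_tmul : ∀ a b, ‖tmul a b‖ = ‖a‖ * ‖b‖
  dense_span : Dense ((Submodule.span ℂ {t : T | ∃ a b, tmul a b = t} : Submodule ℂ T) : Set T)

/-- Data exhibiting `T` as *the minimal (spatial) tensor product* of `A` and `B`: a C*-tensor
product which is dominated by every other C*-tensor product of `A` and `B` (i.e., it carries
the smallest C*-norm). -/
structure MinTensor (A : Type u) (B : Type v) (T : Type w) [NonUnitalCStarAlgebra A]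
    [NonUnitalCStarAlgebra B] [NonUnitalCStarAlgebra T] extends CStarTensor A B T where
  minimal : ∀ (T' : Type (max u v)) [NonUnitalCStarAlgebra T'] (h : CStarTensor A B T'),
    ∃ π : T' →⋆ₙₐ[ℂ] T, ∀ a b, π (h.tmul a b) = tmul a b

/-- The first-factor unital embedding `d ↦ d ⊗ 1`. -/
def MinTensor.fst {D : Type u} {E : Type v} {T : Type w} [CStarAlgebra D] [CStarAlgebra E]
    [CStarAlgebra T] (h : MinTensor D E T) : D → T := fun d => h.tmul d 1

/-- The second-factor unital embedding `d ↦ 1 ⊗ d`. -/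
def MinTensor.snd {D : Type u} {E : Type v} {T : Type w} [CStarAlgebra D] [CStarAlgebra E]
    [CStarAlgebra T] (h : MinTensor D E T) : E → T := fun d => h.tmul 1 d

/-- A unital C*-algebra `D` has *approximately inner half flip* (with respect to a
realization `T` of the minimal tensor product `D ⊗ D`) if the two factor embeddings
`id_D ⊗ 1_D` and `1_D ⊗ id_D` of `D` into `D ⊗ D` are approximately unitarily equivalent. -/
def HasApproxInnerHalfFlip {D : Type u} {T : Type w} [CStarAlgebra D] [CStarAlgebra T]
    (h : MinTensor D D T) : Prop :=
  ApproxUnitaryEquiv h.fst h.snd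

/-- A unital C*-algebra `D` has *approximately inner flip* (with respect to a realization
`T` of `D ⊗ D`) if the flip automorphism `σ_D : a ⊗ b ↦ b ⊗ a` of `D ⊗ D` is approximately
unitarily equivalent to the identity map. -/
def HasApproxInnerFlip {D : Type u} {T : Type w} [CStarAlgebra D] [CStarAlgebra T]
    (h : MinTensor D D T) : Prop :=
  ∃ σ : T ≃⋆ₐ[ℂ] T, (∀ a b, σ (h.tmul a b) = h.tmul b a) ∧
    ApproxUnitaryEquiv (⇑σ) (id : T → T)

/-- A unital C*-algebra `D ≇ ℂ` is *strongly self-absorbing* (with respect to a realization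
`T` of the minimal tensor product `D ⊗ D`) if there is an isomorphism `φ : D → D ⊗ D` which
is approximately unitarily equivalent to `id_D ⊗ 1_D`. -/
def IsStronglySelfAbsorbing {D : Type u} {T : Type w} [CStarAlgebra D] [CStarAlgebra T]
    (h : MinTensor D D T) : Prop :=
  IsEmpty (D ≃⋆ₐ[ℂ] ℂ) ∧ ∃ φ : D ≃⋆ₐ[ℂ] T, ApproxUnitaryEquiv (⇑φ) h.fst

/-- The image of `u` under the upper-left-corner stabilization `u ↦ diag(u, 1, …, 1)`
into `M_{n+1}(A)`. -/
def stabUnitary {A : Type u} [CStarAlgebra A] (n : ℕ) (u : A) :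
    Matrix (Fin (n + 1)) (Fin (n + 1)) A :=
  Matrix.diagonal (fun i => if i = 0 then u else 1)

/-- A unitary `u` represents `0` in `K₁(A)`: some matrix stabilization `diag(u, 1, …, 1)`
is connected to the identity through the unitary group of a matrix algebra over `A`. -/
def RepresentsZeroInK1 {A : Type u} [CStarAlgebra A] (u : A) : Prop :=
  ∃ n : ℕ, ∃ h : stabUnitary n u ∈ unitary (Matrix (Fin (n + 1)) (Fin (n + 1)) A),
    Joined (⟨stabUnitary n u, h⟩ : ↥(unitary (Matrix (Fin (n + 1)) (Fin (n + 1)) A))) 1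

/-- A unital C*-algebra is `K₁`-injective if the canonical map `U(A)/U₀(A) → K₁(A)` is
injective, i.e. every unitary representing `0` in `K₁(A)` lies in the connected component
of the unit of `U(A)`. -/
def K1Injective (A : Type u) [CStarAlgebra A] : Prop :=
  ∀ u : ↥(unitary A), RepresentsZeroInK1 (u : A) → Joined u 1

/-- Positivity in a C*-algebra: `x ≥ 0` iff it is of the form `c* c`. -/
def CStarNonneg {A : Type u} [NonUnitalCStarAlgebra A] (x : A) : Prop := ∃ c, x = star c * c

lemma DoubleCentralizer.coe_one_eq_one (B : Type v) [CStarAlgebra B] :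
    ((1 : B) : 𝓜(ℂ, B)) = 1 := by
  ext : 2 <;> ext <;> simp

lemma DoubleCentralizer.coe_fst_one {B : Type v} [CStarAlgebra B] (m : 𝓜(ℂ, B)) :
    ((m.fst 1 : B) : 𝓜(ℂ, B)) = m := by
  have key : ∀ x, m.fst 1 * x = m.fst x := fun x => by
    have h1 : ∀ y z : B, m.snd y * z = y * m.fst z := m.central
    have h2 : ∀ z, m.snd 1 * z = m.fst z := fun z => by simpa using h1 1 z
    have := h2 1
    rw [mul_one] at this
    rw [← this, h2]
  have key' : ∀ x, x * m.fst 1 = m.snd x := fun x => by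
    rw [← m.central, mul_one]
  ext : 2
  · ext x; simpa using key x
  · ext x; simpa using key' x

lemma DoubleCentralizer.norm_coe_eq {B : Type v} [NonUnitalCStarAlgebra B] (b : B) :
    ‖(b : 𝓜(ℂ, B))‖ = ‖b‖ := by
  rw [← DoubleCentralizer.norm_fst, DoubleCentralizer.coe_fst]
  simp

lemma DoubleCentralizer.coe_injective (B : Type v) [NonUnitalCStarAlgebra B] :
    Function.Injective (DoubleCentralizer.coeHom : B →⋆ₙₐ[ℂ] 𝓜(ℂ, B)) := by
  refine (injective_iff_map_eq_zero _).2 fun b hb => ?_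
  rw [← norm_eq_zero, ← DoubleCentralizer.norm_coe_eq]
  simpa using hb

lemma DoubleCentralizer.mul_coe_eq {B : Type v} [NonUnitalCStarAlgebra B] (m : 𝓜(ℂ, B)) (b : B) :
    m * (b : 𝓜(ℂ, B)) = ((m.fst b : B) : 𝓜(ℂ, B)) := by
  ext : 2
  · ext x
    have h : ∀ y z : B, m.snd y * z = y * m.fst z := m.central
    have : ∀ y, y * m.fst (b * x) = y * (m.fst b * x) := fun y => by
      rw [← h, ← mul_assoc, ← mul_assoc, h]
    simp only [DoubleCentralizer.mul_fst, DoubleCentralizer.coe_fst]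
    have h0 : m.fst (b * x) - m.fst b * x = 0 := by
      have := this (star (m.fst (b * x) - m.fst b * x))
      rw [← sub_eq_zero, ← mul_sub] at this
      exact CStarRing.star_mul_self_eq_zero_iff _ |>.1 this
    simpa using sub_eq_zero.1 h0
  · ext x
    simpa using m.central x b

lemma DoubleCentralizer.coe_mul_eq {B : Type v} [NonUnitalCStarAlgebra B] (m : 𝓜(ℂ, B)) (b : B) :
    (b : 𝓜(ℂ, B)) * m = ((m.snd b : B) : 𝓜(ℂ, B)) := by
  have h := congrArg star (DoubleCentralizer.mul_coe_eq (star m) (star b))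
  have e : ∀ c : B, star (c : 𝓜(ℂ, B)) = ((star c : B) : 𝓜(ℂ, B)) := fun c =>
    (map_star (DoubleCentralizer.coeHom : B →⋆ₙₐ[ℂ] 𝓜(ℂ, B)) c).symm
  rw [star_mul, star_star, e, e, star_star, DoubleCentralizer.star_fst, star_star, star_star] at h
  exact h

/-- On every finite set, `f` is conjugate to `g` by a unitary of `B` up to an arbitrarily small
error. -/
def LocallyConj {D : Type u} {B : Type v} [CStarAlgebra B] (f g : D → B) : Prop :=
  ∀ F : Finset D, ∀ ε : ℝ, 0 < ε → ∃ v ∈ unitary B, ∀ a ∈ F, ‖star v * f a * v - g a‖ < ε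

lemma ApproxUnitaryEquiv.exists_unitary {D : Type u} {B : Type v} [CStarAlgebra B] {f g : D → B}
    (h : ApproxUnitaryEquiv f g) : ∃ v : ℕ → B, (∀ n, v n ∈ unitary B) ∧
      ∀ a, Tendsto (fun n => star (v n) * f a * v n) atTop (𝓝 (g a)) := by
  obtain ⟨v, hv, hlim⟩ := h
  have hinj := DoubleCentralizer.coe_injective B
  let ι : B →⋆ₙₐ[ℂ] 𝓜(ℂ, B) := DoubleCentralizer.coeHom
  have hι : ∀ n, ι ((v n).fst 1) = v n := fun n => DoubleCentralizer.coe_fst_one (v n)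
  have hι1 : ι 1 = 1 := DoubleCentralizer.coe_one_eq_one B
  refine ⟨fun n => (v n).fst 1, fun n => ?_, fun a => ?_⟩
  · have := hv n
    rw [Unitary.mem_iff] at this ⊢
    constructor <;> apply hinj
    · change ι _ = ι _
      rw [map_mul, map_star, hι, hι1, this.1]
    · change ι _ = ι _
      rw [map_mul, map_star, hι, hι1, this.2]
  · rw [tendsto_iff_norm_sub_tendsto_zero]
    convert hlim a using 2 with n
    rw [← DoubleCentralizer.norm_coe_eq]
    congr 1
    change ι _ = star (v n) * ι (f a) * v n - ι (g a)
    rw [map_sub, map_mul, map_mul, map_star, hι]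

lemma norm_le_one_of_mem_unitary {B : Type v} [CStarAlgebra B] {v : B} (hv : v ∈ unitary B) :
    ‖v‖ ≤ 1 := by
  nontriviality B
  exact (CStarRing.norm_of_mem_unitary hv).le

lemma norm_star_mul_mul_le {B : Type v} [CStarAlgebra B] {v : B} (hv : v ∈ unitary B) (x : B) :
    ‖star v * x * v‖ ≤ ‖x‖ := by
  have h1 := norm_le_one_of_mem_unitary hv
  have h2 : ‖star v‖ ≤ 1 := by rwa [norm_star]
  calc ‖star v * x * v‖ ≤ ‖star v‖ * ‖x‖ * ‖v‖ := norm_mul₃_le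
    _ ≤ 1 * ‖x‖ * 1 := by gcongr
    _ = ‖x‖ := by ring

lemma ApproxUnitaryEquiv.locallyConj {D : Type u} {B : Type v} [CStarAlgebra B] {f g : D → B}
    (h : ApproxUnitaryEquiv f g) : LocallyConj f g := by
  obtain ⟨v, hv, hlim⟩ := h.exists_unitary
  intro F ε hε
  have : ∀ᶠ n in atTop, ∀ a ∈ F, ‖star (v n) * f a * v n - g a‖ < ε := by
    rw [eventually_all_finset]
    intro a _
    simpa [dist_eq_norm] using Metric.tendsto_nhds.1 (hlim a) ε hε
  obtain ⟨n, hn⟩ := this.exists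
  exact ⟨v n, hv n, hn⟩

namespace LocallyConj

variable {D : Type u} {E : Type w} {B : Type v} {C : Type x} [CStarAlgebra B] [CStarAlgebra C]
  {f g k : D → B}

lemma symm (h : LocallyConj f g) : LocallyConj g f := by
  intro F ε hε
  obtain ⟨v, hv, hF⟩ := h F ε hε
  refine ⟨star v, Unitary.star_mem hv, fun a ha => ?_⟩
  have e : star (star v) * g a * star v - f a
      = - (star (star v) * (star v * f a * v - g a) * star v) := by
    have h1 := Unitary.mul_star_self_of_mem hv
    have : v * (star v * f a * v) * star v = (v * star v) * f a * (v * star v) := by noncomm_ring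
    rw [h1, one_mul, mul_one] at this
    rw [star_star, mul_sub, sub_mul, this, neg_sub]
  rw [e, norm_neg]
  exact (norm_star_mul_mul_le (Unitary.star_mem hv) _).trans_lt (hF a ha)

lemma trans (h : LocallyConj f g) (h' : LocallyConj g k) : LocallyConj f k := by
  intro F ε hε
  obtain ⟨v, hv, hF⟩ := h F (ε / 2) (half_pos hε)
  obtain ⟨w, hw, hF'⟩ := h' F (ε / 2) (half_pos hε)
  refine ⟨v * w, mul_mem hv hw, fun a ha => ?_⟩
  have e : star (v * w) * f a * (v * w) - k a
      = star w * (star v * f a * v - g a) * w + (star w * g a * w - k a) := by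
    rw [star_mul]; noncomm_ring
  rw [e]
  calc _ ≤ _ := norm_add_le _ _
    _ < ε / 2 + ε / 2 := by
      gcongr
      · exact (norm_star_mul_mul_le hw _).trans_lt (hF a ha)
      · exact hF' a ha
    _ = ε := by ring

lemma comp_right (h : LocallyConj f g) (α : E → D) : LocallyConj (f ∘ α) (g ∘ α) := by
  classical
  intro F ε hε
  obtain ⟨v, hv, hF⟩ := h (F.image α) ε hε
  exact ⟨v, hv, fun a ha => hF (α a) (Finset.mem_image_of_mem α ha)⟩

lemma comp_left (h : LocallyConj f g) (π : B →⋆ₙₐ[ℂ] C) (hπ : π 1 = 1) :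
    LocallyConj (π ∘ f) (π ∘ g) := by
  intro F ε hε
  obtain ⟨v, hv, hF⟩ := h F ε hε
  refine ⟨π v, ?_, fun a ha => ?_⟩
  · rw [Unitary.mem_iff] at hv ⊢
    rw [← map_star, ← map_mul, ← map_mul, hv.1, hv.2]
    exact ⟨hπ, hπ⟩
  · refine lt_of_le_of_lt ?_ (hF a ha)
    have := NonUnitalStarAlgHom.norm_apply_le π (star v * f a * v - g a)
    simpa only [map_sub, map_mul, map_star, Function.comp_apply] using this

end LocallyConj

lemma NonUnitalStarAlgHom.continuous_of_cstar {A : Type u} {B : Type v} [NonUnitalCStarAlgebra A]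
    [NonUnitalCStarAlgebra B] (f : A →⋆ₙₐ[ℂ] B) : Continuous f :=
  AddMonoidHomClass.continuous_of_bound f 1 fun a => by
    simpa using NonUnitalStarAlgHom.norm_apply_le f a

namespace CStarTensor

variable {A : Type u} {B : Type v} {T : Type w} [NonUnitalCStarAlgebra A]
  [NonUnitalCStarAlgebra B] [NonUnitalCStarAlgebra T]

lemma zero_tmul (h : CStarTensor A B T) (b : B) : h.tmul 0 b = 0 := by
  simpa using h.smul_left 0 0 b

/-- A closed, additive property which holds on elementary tensors holds everywhere. -/
lemma induction_on (h : CStarTensor A B T) {p : T → Prop} (hp : IsClosed {t | p t})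
    (htmul : ∀ a b, p (h.tmul a b)) (hadd : ∀ s t, p s → p t → p (s + t)) (t : T) : p t := by
  have : ((Submodule.span ℂ {t : T | ∃ a b, h.tmul a b = t} : Submodule ℂ T) : Set T)
      ⊆ {t | p t} := by
    intro t ht
    induction ht using Submodule.closure_induction with
    | zero => simpa [h.zero_tmul] using htmul 0 0
    | add s t _ _ hs ht => exact hadd s t hs ht
    | smul_mem c t ht =>
      obtain ⟨a, b, rfl⟩ := ht
      simpa [h.smul_left] using htmul (c • a) b
  exact hp.closure_subset_iff.2 this (h.dense_span t)

/-- The linear map from the algebraic tensor product. -/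
def lift (h : CStarTensor A B T) : A ⊗[ℂ] B →ₗ[ℂ] T :=
  TensorProduct.lift (LinearMap.mk₂ ℂ h.tmul h.add_left h.smul_left h.add_right h.smul_right)

@[simp] lemma lift_tmul (h : CStarTensor A B T) (a : A) (b : B) :
    h.lift (a ⊗ₜ b) = h.tmul a b := rfl

lemma denseRange_lift (h : CStarTensor A B T) : DenseRange h.lift := by
  intro t
  refine h.induction_on (p := fun t => t ∈ closure (Set.range h.lift)) isClosed_closure
    (fun a b => subset_closure ⟨a ⊗ₜ b, rfl⟩) (fun s t hs ht => ?_) t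
  rw [← LinearMap.coe_range] at hs ht ⊢
  exact (LinearMap.range h.lift).topologicalClosure.add_mem hs ht

end CStarTensor

section HalfFlip

variable {D : Type u} {TD : Type u} [CStarAlgebra D] [CStarAlgebra TD]

lemma MinTensor.exists_flip (hD : MinTensor D D TD) :
    ∃ σ : TD →⋆ₙₐ[ℂ] TD, (∀ a b, σ (hD.tmul a b) = hD.tmul b a) ∧ ∀ t, σ (σ t) = t := by
  obtain ⟨σ, hσ⟩ := hD.minimal TD
    { tmul := fun a b => hD.tmul b a
      add_left := fun a a' b => hD.add_right b a a'
      add_right := fun a b b' => hD.add_left b b' a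
      smul_left := fun c a b => hD.smul_right c b a
      smul_right := fun c a b => hD.smul_left c b a
      mul_tmul := fun a a' b b' => hD.mul_tmul b b' a a'
      star_tmul := fun a b => hD.star_tmul b a
      norm_tmul := fun a b => by rw [hD.norm_tmul, mul_comm]
      dense_span := by
        convert hD.dense_span using 3
        ext t
        exact exists_comm }
  have hcont : Continuous σ := σ.continuous_of_cstar
  refine ⟨σ, fun a b => hσ b a, fun t => ?_⟩
  refine hD.induction_on (p := fun t => σ (σ t) = t)
    (isClosed_eq (hcont.comp hcont) continuous_id) (fun a b => ?_) (fun s t hs ht => ?_) t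
  · rw [hσ b a, hσ a b]
  · rw [map_add, map_add, hs, ht]

lemma MinTensor.exists_map_left (hD : MinTensor D D TD) (θ : D →⋆ₙₐ[ℂ] D)
    (hθ : ∀ d, θ (θ d) = d) :
    ∃ τ : TD →⋆ₙₐ[ℂ] TD, ∀ a b, τ (hD.tmul a b) = hD.tmul (θ a) b := by
  have hnorm : ∀ d, ‖θ d‖ = ‖d‖ := fun d =>
    NonUnitalStarAlgHom.norm_map θ (Function.LeftInverse.injective hθ) d
  obtain ⟨τ, hτ⟩ := hD.minimal TD
    { tmul := fun a b => hD.tmul (θ a) b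
      add_left := fun a a' b => by rw [map_add, hD.add_left]
      add_right := fun a b b' => hD.add_right _ b b'
      smul_left := fun c a b => by rw [map_smul, hD.smul_left]
      smul_right := fun c a b => hD.smul_right c _ b
      mul_tmul := fun a a' b b' => by rw [hD.mul_tmul, map_mul]
      star_tmul := fun a b => by rw [hD.star_tmul, map_star]
      norm_tmul := fun a b => by rw [hD.norm_tmul, hnorm]
      dense_span := by
        convert hD.dense_span using 3
        ext t
        constructor
        · rintro ⟨a, b, rfl⟩
          exact ⟨θ a, b, rfl⟩
        · rintro ⟨a, b, rfl⟩
          exact ⟨θ a, b, by rw [hθ]⟩ }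
  refine ⟨τ, fun a b => ?_⟩
  have : τ (hD.tmul (θ (θ a)) b) = hD.tmul (θ a) b := hτ (θ a) b
  rwa [hθ] at this

/-- Two commuting unital embeddings of `D` into itself coming from an isomorphism
`D ⊗ D ≅ D`, together with the identity, are mutually approximately unitarily equivalent. -/
lemma IsStronglySelfAbsorbing.exists_locallyConj {hD : MinTensor D D TD} (hDu : hD.tmul 1 1 = 1)
    (hssa : IsStronglySelfAbsorbing hD) : ∃ φ : D ≃⋆ₐ[ℂ] TD,
      ApproxUnitaryEquiv (⇑φ) hD.fst ∧ LocallyConj (φ.symm ∘ hD.snd) (φ.symm ∘ hD.fst) := by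
  obtain ⟨-, φ, hφ⟩ := hssa
  obtain ⟨σ, hσ, hσσ⟩ := hD.exists_flip
  let ψ : TD →⋆ₙₐ[ℂ] D := (φ.symm : TD →⋆ₐ[ℂ] D).toNonUnitalStarAlgHom
  let φ' : D →⋆ₙₐ[ℂ] TD := (φ : D →⋆ₐ[ℂ] TD).toNonUnitalStarAlgHom
  have hψφ : ∀ d, ψ (φ' d) = d := φ.symm_apply_apply
  have hφψ : ∀ t, φ' (ψ t) = t := φ.apply_symm_apply
  have hψ1 : ψ 1 = 1 := map_one φ.symm
  have hφ1 : φ' 1 = 1 := map_one φ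
  let θ : D →⋆ₙₐ[ℂ] D := (ψ.comp σ).comp φ'
  have hθ : ∀ d, θ d = ψ (σ (φ' d)) := fun d => rfl
  have hθθ : ∀ d, θ (θ d) = d := fun d => by
    rw [hθ, hθ, hφψ, hσσ, hψφ]
  obtain ⟨τ, hτ⟩ := hD.exists_map_left θ hθθ
  have hσ1 : σ 1 = 1 := by rw [← hDu, hσ]
  have hθ1 : θ 1 = 1 := by rw [hθ, hφ1, hσ1, hψ1]
  have hτ1 : τ 1 = 1 := by rw [← hDu, hτ, hθ1]
  let γ : D →⋆ₙₐ[ℂ] D := (ψ.comp τ).comp φ'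
  have hγ : ∀ d, γ d = ψ (τ (φ' d)) := fun d => rfl
  have hγ1 : γ 1 = 1 := by rw [hγ, hφ1, hτ1, hψ1]
  have hl : LocallyConj (id : D → D) (ψ ∘ hD.fst) := by
    have := hφ.locallyConj.comp_left ψ hψ1
    rwa [show ψ ∘ φ = id from funext hψφ] at this
  have h1 : LocallyConj γ (θ : D → D) := by
    refine (hl.comp_left γ hγ1).trans ?_
    have : γ ∘ (ψ ∘ hD.fst) = (ψ ∘ hD.fst) ∘ θ := by
      funext d
      change γ (ψ (hD.tmul d 1)) = ψ (hD.tmul (θ d) 1)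
      rw [hγ, hφψ, hτ]
    rw [this]
    exact hl.symm.comp_right θ
  have h2 := h1.comp_right (ψ ∘ hD.snd)
  have e1 : γ ∘ (ψ ∘ hD.snd) = ψ ∘ hD.snd := by
    funext d
    change γ (ψ (hD.tmul 1 d)) = ψ (hD.tmul 1 d)
    rw [hγ, hφψ, hτ, hθ1]
  have e2 : θ ∘ (ψ ∘ hD.snd) = ψ ∘ hD.fst := by
    funext d
    change θ (ψ (hD.tmul 1 d)) = ψ (hD.tmul d 1)
    rw [hθ, hφψ, hσ]
  rw [e1, e2] at h2
  exact ⟨φ, hφ, h2⟩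

end HalfFlip

section Commutator

variable {D : Type u} [CStarAlgebra D]

lemma norm_commutator_conj_le {c : D} (hc : c ∈ unitary D) (g y : D) :
    ‖g * (c * y * star c) - (c * y * star c) * g‖
      ≤ ‖(star c * g * c) * y - y * (star c * g * c)‖ := by
  have e : g * (c * y * star c) - (c * y * star c) * g
      = star (star c) * ((star c * g * c) * y - y * (star c * g * c)) * star c := by
    have h1 := Unitary.mul_star_self_of_mem hc
    calc g * (c * y * star c) - (c * y * star c) * g
        = 1 * g * (c * y * star c) - (c * y * star c) * g * 1 := by rw [one_mul, mul_one]
      _ = _ := by rw [← h1, star_star]; noncomm_ring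
  rw [e]
  exact norm_star_mul_mul_le (Unitary.star_mem hc) _

lemma norm_commutator_le {y : D} (hy : ‖y‖ ≤ 1) {g k z : D} (hkz : k * z = z * k) :
    ‖g * y - y * g‖ ≤ 2 * ‖g - k‖ + 2 * ‖k‖ * ‖y - z‖ := by
  have e : g * y - y * g = ((g - k) * y - y * (g - k)) + (k * (y - z) - (y - z) * k) := by
    have : k * z - z * k = 0 := sub_eq_zero.2 hkz
    calc g * y - y * g = g * y - y * g - (k * z - z * k) := by rw [this, sub_zero]
      _ = _ := by noncomm_ring
  rw [e]
  calc _ ≤ (‖g - k‖ * ‖y‖ + ‖y‖ * ‖g - k‖) + (‖k‖ * ‖y - z‖ + ‖y - z‖ * ‖k‖) := by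
        refine (norm_add_le _ _).trans (add_le_add ?_ ?_) <;>
        exact (norm_sub_le _ _).trans (add_le_add (norm_mul_le _ _) (norm_mul_le _ _))
    _ ≤ (‖g - k‖ * 1 + 1 * ‖g - k‖) + (‖k‖ * ‖y - z‖ + ‖y - z‖ * ‖k‖) := by gcongr
    _ = _ := by ring

/-- The unitaries conjugating `ρ` to `l` may be chosen to be multiplicative commutators. -/
lemma LocallyConj.exists_commutator {l ρ : D →⋆ₙₐ[ℂ] D}
    (hcomm : ∀ a b, l a * ρ b = ρ b * l a) (hl : LocallyConj (id : D → D) l)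
    (hρ : LocallyConj ρ l) (F : Finset D) {ε : ℝ} (hε : 0 < ε) :
    ∃ u ∈ unitary D, ∃ x ∈ unitary D, ∀ a ∈ F,
      ‖star (u * x * star u * star x) * ρ a * (u * x * star u * star x) - l a‖ < ε := by
  classical
  obtain ⟨u, hu, hF⟩ := hρ F (ε / 2) (half_pos hε)
  obtain ⟨c, hc, hcF⟩ := hl (F.image l) (ε / 8) (by positivity)
  set M : ℝ := ∑ a ∈ F, ‖a‖ with hM
  have hM0 : 0 ≤ M := Finset.sum_nonneg fun a _ => norm_nonneg a
  obtain ⟨e, he, heu⟩ := hl.trans hρ.symm {star u} (ε / (8 * (M + 1))) (by positivity)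
  have heu := heu (star u) (Finset.mem_singleton_self _)
  simp only [id] at heu hcF
  have hx : c * star e ∈ unitary D := mul_mem hc (Unitary.star_mem he)
  refine ⟨u, hu, c * star e, hx, fun a ha => ?_⟩
  set y := star e * star u * e with hy
  have hyu : y ∈ unitary D :=
    mul_mem (mul_mem (Unitary.star_mem he) (Unitary.star_mem hu)) he
  set z := c * y * star c with hz
  have hzu : z ∈ unitary D := mul_mem (mul_mem hc hyu) (Unitary.star_mem hc)
  have hv : u * (c * star e) * star u * star (c * star e) = u * z := by
    rw [hz, hy, star_mul, star_star]; noncomm_ring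
  have hcg := hcF (l a) (Finset.mem_image_of_mem _ ha)
  have haM : ‖a‖ ≤ M := Finset.single_le_sum (f := fun a => ‖a‖) (fun a _ => norm_nonneg a) ha
  have hla : ‖l (l a)‖ ≤ M :=
    (NonUnitalStarAlgHom.norm_apply_le l _).trans
      ((NonUnitalStarAlgHom.norm_apply_le l a).trans haM)
  have h1 : ‖l a * z - z * l a‖ < ε / 2 := by
    calc _ ≤ ‖(star c * l a * c) * y - y * (star c * l a * c)‖ := norm_commutator_conj_le hc _ _
      _ ≤ 2 * ‖star c * l a * c - l (l a)‖ + 2 * ‖l (l a)‖ * ‖y - ρ (star u)‖ :=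
        norm_commutator_le (norm_le_one_of_mem_unitary hyu) (hcomm _ _)
      _ < 2 * (ε / 8) + 2 * (M + 1) * (ε / (8 * (M + 1))) := by
        refine add_lt_add_of_lt_of_le (by gcongr) ?_
        gcongr
        linarith
      _ = ε / 2 := by field_simp; ring
  rw [hv]
  have e1 : star (u * z) * ρ a * (u * z) - l a
      = star z * (star u * ρ a * u - l a) * z + star z * (l a * z - z * l a) := by
    have h1 := Unitary.star_mul_self_of_mem hzu
    calc star (u * z) * ρ a * (u * z) - l a
        = star (u * z) * ρ a * (u * z) - 1 * l a := by rw [one_mul]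
      _ = _ := by rw [← h1, star_mul]; noncomm_ring
  rw [e1]
  calc _ ≤ _ := norm_add_le _ _
    _ < ε / 2 + ε / 2 := by
      refine add_lt_add ((norm_star_mul_mul_le hzu _).trans_lt (hF a ha)) ?_
      refine (norm_mul_le _ _).trans_lt (lt_of_le_of_lt ?_ h1)
      exact mul_le_of_le_one_left (norm_nonneg _)
        (norm_le_one_of_mem_unitary (Unitary.star_mem hzu))
    _ = ε := by ring

end Commutator

section Rotation

variable {D : Type u} [CStarAlgebra D]

/-- The rotation matrix with scalar entries. -/
def rotationMatrix (D : Type u) [CStarAlgebra D] (t : ℝ) : Matrix (Fin 2) (Fin 2) D :=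
  !![(Real.cos t : ℂ) • (1 : D), -((Real.sin t : ℂ) • (1 : D));
    (Real.sin t : ℂ) • (1 : D), (Real.cos t : ℂ) • (1 : D)]

lemma rotationMatrix_mem_unitary (t : ℝ) :
    rotationMatrix D t ∈ unitary (Matrix (Fin 2) (Fin 2) D) := by
  have h := Complex.cos_sq_add_sin_sq t
  have h' : Complex.cos t * Complex.cos t + Complex.sin t * Complex.sin t = 1 := by
    rw [← h]; ring
  rw [Unitary.mem_iff]
  constructor <;>
  · ext i j
    fin_cases i <;> fin_cases j <;>
      simp [rotationMatrix, Matrix.mul_apply, Fin.sum_univ_two, Matrix.star_apply, star_smul,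
        smul_smul, ← add_smul, mul_comm, h', ← Complex.cos_conj, ← Complex.sin_conj]
    all_goals try rw [add_comm, h', one_smul]

lemma diagonal_mem_unitary {n : ℕ} {d : Fin n → D} (h : ∀ i, d i ∈ unitary D) :
    Matrix.diagonal d ∈ unitary (Matrix (Fin n) (Fin n) D) := by
  rw [Unitary.mem_iff, Matrix.star_eq_conjTranspose, Matrix.diagonal_conjTranspose,
    Matrix.diagonal_mul_diagonal, Matrix.diagonal_mul_diagonal, ← Matrix.diagonal_one]
  constructor <;> congr 1 <;> funext i
  · exact Unitary.star_mul_self_of_mem (h i)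
  · exact Unitary.mul_star_self_of_mem (h i)

lemma joined_diagonal_swap {x : D}
    (h : Matrix.diagonal ![x, 1] ∈ unitary (Matrix (Fin 2) (Fin 2) D))
    (h' : Matrix.diagonal ![1, x] ∈ unitary (Matrix (Fin 2) (Fin 2) D)) :
    Joined (⟨_, h⟩ : unitary (Matrix (Fin 2) (Fin 2) D)) ⟨_, h'⟩ := by
  let f : ℝ → unitary (Matrix (Fin 2) (Fin 2) D) := fun t =>
    ⟨rotationMatrix D t * Matrix.diagonal ![x, 1] * star (rotationMatrix D t),
      mul_mem (mul_mem (rotationMatrix_mem_unitary t) h)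
        (Unitary.star_mem (rotationMatrix_mem_unitary t))⟩
  have hR : Continuous (rotationMatrix D) := by
    refine continuous_matrix fun i j => ?_
    fin_cases i <;> fin_cases j <;> simp [rotationMatrix] <;> fun_prop
  have hf : Continuous f := by
    refine Continuous.subtype_mk ?_ _
    exact (hR.matrix_mul continuous_const).matrix_mul hR.matrix_conjTranspose
  have h0 : f 0 = ⟨_, h⟩ := by
    apply Subtype.ext
    ext i j
    fin_cases i <;> fin_cases j <;>
      simp [f, rotationMatrix, Matrix.mul_apply, Fin.sum_univ_two, Matrix.star_apply,
        Matrix.vecMul_diagonal]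
  have h1 : f (Real.pi / 2) = ⟨_, h'⟩ := by
    apply Subtype.ext
    ext i j
    fin_cases i <;> fin_cases j <;>
      simp [f, rotationMatrix, Matrix.mul_apply, Fin.sum_univ_two, Matrix.star_apply,
        Matrix.vecMul_diagonal]
  rw [← h0, ← h1]
  exact (PathConnectedSpace.joined 0 (Real.pi / 2)).map hf

lemma representsZeroInK1_commutator {u x : D} (hu : u ∈ unitary D) (hx : x ∈ unitary D) :
    RepresentsZeroInK1 (u * x * star u * star x) := by
  have hmem : ∀ {a b : D}, a ∈ unitary D → b ∈ unitary D →
      Matrix.diagonal ![a, b] ∈ unitary (Matrix (Fin 2) (Fin 2) D) := fun ha hb =>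
    diagonal_mem_unitary fun i => by fin_cases i <;> assumption
  have h1 : (1 : D) ∈ unitary D := one_mem _
  have hs : stabUnitary 1 (u * x * star u * star x)
      = Matrix.diagonal ![u * x * star u * star x, 1] := by
    unfold stabUnitary
    congr 1
    funext i
    fin_cases i <;> rfl
  have hv : u * x * star u * star x ∈ unitary D :=
    mul_mem (mul_mem (mul_mem hu hx) (Unitary.star_mem hu)) (Unitary.star_mem hx)
  refine ⟨1, hs ▸ hmem hv h1, ?_⟩
  let U : unitary (Matrix (Fin 2) (Fin 2) D) := ⟨_, hmem hu h1⟩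
  have hj := joined_diagonal_swap (hmem hx h1) (hmem h1 hx)
  have hc : Continuous fun Y : unitary (Matrix (Fin 2) (Fin 2) D) => U * Y * star U * star Y := by
    refine Continuous.subtype_mk ?_ _
    have hY : Continuous fun Y : unitary (Matrix (Fin 2) (Fin 2) D) =>
      (Y : Matrix (Fin 2) (Fin 2) D) := continuous_subtype_val
    exact ((continuous_const.matrix_mul hY).matrix_mul continuous_const).matrix_mul
      hY.matrix_conjTranspose
  convert hj.map hc using 1
  · apply Subtype.ext
    simp [hs, U, Matrix.star_eq_conjTranspose, Matrix.diagonal_conjTranspose,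
      Matrix.diagonal_mul_diagonal]
  · apply Subtype.ext
    simp [U, Matrix.star_eq_conjTranspose, Matrix.diagonal_conjTranspose,
      Matrix.diagonal_mul_diagonal]
    rw [← Matrix.diagonal_one, eq_comm]
    congr 1
    funext i
    fin_cases i
    · simpa using Unitary.mul_star_self_of_mem hu
    · simpa using Unitary.mul_star_self_of_mem hx

lemma K1Injective.exists_exp_of_commutator (hK : K1Injective D) {u x : D} (hu : u ∈ unitary D)
    (hx : x ∈ unitary D) : ∃ l : List (selfAdjoint D),
      ((l.map selfAdjoint.expUnitary).prod : D) = u * x * star u * star x := by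
  have hv : u * x * star u * star x ∈ unitary D :=
    mul_mem (mul_mem (mul_mem hu hx) (Unitary.star_mem hu)) (Unitary.star_mem hx)
  have hj : Joined (⟨_, hv⟩ : unitary D) 1 := hK ⟨_, hv⟩ (representsZeroInK1_commutator hu hx)
  obtain ⟨l, hl⟩ := Unitary.mem_pathComponentOne_iff.1
    (show (⟨_, hv⟩ : unitary D) ∈ pathComponent 1 from hj.symm)
  exact ⟨l, congrArg Subtype.val hl⟩

end Rotation

section Simple

variable {D : Type u} [CStarAlgebra D]

/-- An ideal contains approximate left units for its finite subsets. -/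
lemma exists_approx_left_unit [PartialOrder D] [StarOrderedRing D] (J : Submodule ℂ D)
    (hr : ∀ a, ∀ b ∈ J, b * a ∈ J) (C : Finset D) (hC : ∀ c ∈ C, c ∈ J) {η : ℝ} (hη : 0 < η) :
    ∃ h : D, 1 - h ∈ J ∧ ‖h‖ ≤ 1 ∧ ∀ c ∈ C, ‖h * c‖ ≤ η := by
  set c : D := ∑ a ∈ C, a * star a with hc
  have hc0 : 0 ≤ c := Finset.sum_nonneg fun a _ => mul_star_self_nonneg a
  have hcJ : c ∈ J := Submodule.sum_mem _ fun a ha => hr _ _ (hC a ha)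
  have hcC : ∀ a ∈ C, a * star a ≤ c := fun a ha =>
    Finset.single_le_sum (f := fun a => a * star a) (fun a _ => mul_star_self_nonneg a) ha
  clear_value c
  have hcs : IsSelfAdjoint c := .of_nonneg hc0
  obtain ⟨δ, hδ⟩ : ∃ δ : ℝ, δ = η ^ 2 := ⟨_, rfl⟩
  have hδ0 : 0 < δ := by rw [hδ]; positivity
  have hspec : ∀ s ∈ spectrum ℝ c, 0 ≤ s := fun s hs => spectrum_nonneg_of_nonneg hc0 hs
  have hcont : ContinuousOn (fun s : ℝ => (s + δ)⁻¹) (spectrum ℝ c) := by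
    refine ContinuousOn.inv₀ (by fun_prop) fun s hs => ?_
    have := hspec s hs
    positivity
  have hcont' : ContinuousOn (fun s : ℝ => δ * (s + δ)⁻¹) (spectrum ℝ c) :=
    continuousOn_const.mul hcont
  set h : D := cfc (fun s : ℝ => δ * (s + δ)⁻¹) c with hh
  have hsa : star h = h := (IsSelfAdjoint.cfc (f := fun s : ℝ => δ * (s + δ)⁻¹) (a := c)).star_eq
  refine ⟨h, ?_, ?_, fun a ha => ?_⟩
  · have : 1 - h = c * cfc (fun s : ℝ => (s + δ)⁻¹) c := by
      have h1 : cfc (fun _ : ℝ => (1 : ℝ)) c = 1 := cfc_one ℝ c hcs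
      have h2 := cfc_mul (fun s : ℝ => s) (fun s : ℝ => (s + δ)⁻¹) c (continuousOn_id' _) hcont
      have h3 := cfc_sub (fun _ : ℝ => (1 : ℝ)) (fun s : ℝ => δ * (s + δ)⁻¹) c
        continuousOn_const hcont'
      rw [cfc_id' ℝ c hcs] at h2
      rw [h1] at h3
      rw [← h2, hh, ← h3]
      refine cfc_congr fun s hs => ?_
      have := hspec s hs
      have : s + δ ≠ 0 := by positivity
      field_simp
      ring
    rw [this]
    exact hr _ _ hcJ
  · refine norm_cfc_le zero_le_one fun s hs => ?_
    have := hspec s hs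
    rw [Real.norm_of_nonneg (by positivity), ← div_eq_mul_inv, div_le_one (by positivity)]
    linarith
  · have h1 : h * (a * star a) * star h ≤ h * c * star h :=
      star_right_conjugate_le_conjugate
        (hcC a ha) h
    have h2 : ‖h * c * star h‖ ≤ δ := by
      have : h * c * star h = cfc (fun s : ℝ => δ * (s + δ)⁻¹ * s * (δ * (s + δ)⁻¹)) c := by
        have h2 := cfc_mul (fun s : ℝ => δ * (s + δ)⁻¹) (fun s : ℝ => s) c hcont'
          (continuousOn_id' _)
        rw [cfc_id' ℝ c hcs] at h2
        have h3 := cfc_mul (fun s : ℝ => δ * (s + δ)⁻¹ * s) (fun s : ℝ => δ * (s + δ)⁻¹) c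
          (hcont'.mul (continuousOn_id' _)) hcont'
        rw [hsa, h3, h2]
      rw [this]
      refine norm_cfc_le hδ0.le fun s hs => ?_
      have := hspec s hs
      rw [Real.norm_of_nonneg (by positivity)]
      have e : δ * (s + δ)⁻¹ * s * (δ * (s + δ)⁻¹) = δ * (δ * s) / (s + δ) ^ 2 := by
        field_simp
      rw [e, div_le_iff₀ (by positivity)]
      gcongr
      nlinarith
    have h3 : ‖h * a‖ ^ 2 ≤ η ^ 2 := by
      have e : h * a * star (h * a) = h * (a * star a) * star h := by
        rw [star_mul]; noncomm_ring
      rw [← hδ, sq, ← CStarRing.norm_self_mul_star, e]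
      refine le_trans (CStarAlgebra.norm_le_norm_of_nonneg_of_le ?_ h1) h2
      rw [← e]
      exact mul_star_self_nonneg _
    exact abs_le_of_sq_le_sq' h3 hη.le |>.2

variable {TD : Type u} [CStarAlgebra TD]

/-- An approximately inner half flip forces simplicity. -/
lemma CStarTensor.eq_zero_of_mem_ideal (hD : CStarTensor D D TD)
    (hflip : LocallyConj (fun d => hD.tmul d 1) (fun d => hD.tmul 1 d)) (J : Submodule ℂ D)
    (hl : ∀ a, ∀ b ∈ J, a * b ∈ J) (hr : ∀ a, ∀ b ∈ J, b * a ∈ J) (hJ : (1 : D) ∉ J) :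
    ∀ b ∈ J, b = 0 := by
  let _ := CStarAlgebra.spectralOrder D
  let _ := CStarAlgebra.spectralOrderedRing D
  classical
  intro b hb
  set S : Submodule ℂ TD := Submodule.span ℂ {t | ∃ j ∈ J, ∃ d, hD.tmul j d = t} with hS
  have hSl : ∀ s ∈ S.topologicalClosure, ∀ t, t * s ∈ S.topologicalClosure := by
    intro s hs t
    refine hD.induction_on (p := fun t => t * s ∈ S.topologicalClosure)
      (S.isClosed_topologicalClosure.preimage (continuous_mul_const s)) (fun x y => ?_)
      (fun t t' ht ht' => by rw [add_mul]; exact add_mem ht ht') t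
    have : S ≤ S.comap (LinearMap.mulLeft ℂ (hD.tmul x y)) := by
      refine Submodule.span_le.2 ?_
      rintro _ ⟨j, hj, d, rfl⟩
      exact Submodule.subset_span ⟨x * j, hl x j hj, y * d, (hD.mul_tmul x j y d).symm⟩
    exact map_mem_closure (f := fun s => hD.tmul x y * s) (continuous_const_mul _) hs this
  have hSr : ∀ s ∈ S.topologicalClosure, ∀ t, s * t ∈ S.topologicalClosure := by
    intro s hs t
    refine hD.induction_on (p := fun t => s * t ∈ S.topologicalClosure)
      (S.isClosed_topologicalClosure.preimage (continuous_const_mul s)) (fun x y => ?_)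
      (fun t t' ht ht' => by rw [mul_add]; exact add_mem ht ht') t
    have : S ≤ S.comap (LinearMap.mulRight ℂ (hD.tmul x y)) := by
      refine Submodule.span_le.2 ?_
      rintro _ ⟨j, hj, d, rfl⟩
      exact Submodule.subset_span ⟨j * x, hr x j hj, d * y, (hD.mul_tmul j x d y).symm⟩
    exact map_mem_closure (f := fun s => s * hD.tmul x y) (continuous_mul_const _) hs this
  have hbS : hD.tmul 1 b ∈ S.topologicalClosure := by
    change _ ∈ closure (S : Set TD)
    rw [← closure_closure, Metric.mem_closure_iff]
    intro ε hε
    obtain ⟨v, -, hv⟩ := hflip {b} ε hε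
    refine ⟨_, hSr _ (hSl _ (S.le_topologicalClosure (Submodule.subset_span ⟨b, hb, 1, rfl⟩))
      (star v)) v, ?_⟩
    rw [dist_comm, dist_eq_norm]
    exact hv b (Finset.mem_singleton_self b)
  have hQ : ∀ z ∈ S, ∃ C : Finset D, (∀ c ∈ C, c ∈ J) ∧ ∃ M : ℝ, 0 ≤ M ∧ ∀ h : D, ∀ η : ℝ,
      0 ≤ η → (∀ c ∈ C, ‖h * c‖ ≤ η) → ‖hD.tmul h 1 * z‖ ≤ M * η := by
    intro z hz
    induction hz using Submodule.span_induction with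
    | mem z hz =>
      obtain ⟨j, hj, d, rfl⟩ := hz
      refine ⟨{j}, by simpa using hj, ‖d‖, norm_nonneg d, fun h η hη hh => ?_⟩
      rw [hD.mul_tmul, hD.norm_tmul, one_mul, mul_comm]
      exact mul_le_mul_of_nonneg_left (hh j (Finset.mem_singleton_self j)) (norm_nonneg d)
    | zero => exact ⟨∅, by simp, 0, le_rfl, by simp⟩
    | add y z _ _ hy hz =>
      obtain ⟨C, hC, M, hM, hb⟩ := hy
      obtain ⟨C', hC', M', hM', hb'⟩ := hz
      refine ⟨C ∪ C', fun c hc => (Finset.mem_union.1 hc).elim (hC c) (hC' c), M + M',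
        add_nonneg hM hM', fun h η hη hh => ?_⟩
      rw [mul_add, add_mul]
      exact (norm_add_le _ _).trans (add_le_add
        (hb h η hη fun c hc => hh c (Finset.mem_union_left _ hc))
        (hb' h η hη fun c hc => hh c (Finset.mem_union_right _ hc)))
    | smul a z _ hz =>
      obtain ⟨C, hC, M, hM, hb⟩ := hz
      refine ⟨C, hC, ‖a‖ * M, by positivity, fun h η hη hh => ?_⟩
      rw [mul_smul_comm, norm_smul, mul_assoc]
      exact mul_le_mul_of_nonneg_left (hb h η hη hh) (norm_nonneg a)
  rw [← norm_le_zero_iff]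
  refine le_of_forall_pos_le_add fun ε hε => ?_
  rw [zero_add]
  obtain ⟨z, hz, hzb⟩ := Metric.mem_closure_iff.1
    (show hD.tmul 1 b ∈ closure (S : Set TD) from hbS) (ε / 2) (half_pos hε)
  obtain ⟨C, hC, M, hM, hCM⟩ := hQ z hz
  obtain ⟨h, hh, hh1, hhC⟩ := exists_approx_left_unit J hr C hC
    (show 0 < ε / (2 * (M + 1)) by positivity)
  have hn : 1 ≤ ‖h‖ := by
    by_contra hlt
    rw [not_le] at hlt
    obtain ⟨k, hk⟩ := (isUnit_one_sub_of_norm_lt_one hlt)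
    apply hJ
    rw [← k.inv_mul, hk]
    exact hl _ _ hh
  have h1 : ‖(1 : D)‖ ≤ 1 := norm_le_one_of_mem_unitary (one_mem _)
  calc ‖b‖ ≤ ‖h‖ * ‖b‖ := le_mul_of_one_le_left (norm_nonneg b) hn
    _ = ‖hD.tmul h 1 * hD.tmul 1 b‖ := by rw [hD.mul_tmul, mul_one, one_mul, hD.norm_tmul]
    _ = ‖hD.tmul h 1 * (hD.tmul 1 b - z) + hD.tmul h 1 * z‖ := by rw [mul_sub, sub_add_cancel]
    _ ≤ ‖hD.tmul h 1‖ * ‖hD.tmul 1 b - z‖ + ‖hD.tmul h 1 * z‖ :=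
      (norm_add_le _ _).trans (add_le_add_left (norm_mul_le _ _) _)
    _ ≤ 1 * (ε / 2) + (M + 1) * (ε / (2 * (M + 1))) := by
      refine add_le_add ?_ ?_
      · refine mul_le_mul ?_ (by rw [← dist_eq_norm]; exact hzb.le) (norm_nonneg _) zero_le_one
        rw [hD.norm_tmul]
        exact mul_le_one₀ hh1 (norm_nonneg _) h1
      · refine (hCM h _ (by positivity) hhC).trans ?_
        gcongr
        linarith
    _ = ε := by field_simp; norm_num

end Simple

section CrossNorm

variable {D : Type u} {M : Type v} [CStarAlgebra D] [CStarAlgebra M]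

lemma norm_mul_le_norm_mul_of_nonneg [PartialOrder D] [StarOrderedRing D]
    (hsimple : ∀ J : Submodule ℂ D, (∀ a, ∀ b ∈ J, a * b ∈ J) → (∀ a, ∀ b ∈ J, b * a ∈ J) →
      (1 : D) ∉ J → ∀ b ∈ J, b = 0)
    (ρ : D →⋆ₙₐ[ℂ] M) (hρ : ρ 1 = 1) {x : M} (hx : IsSelfAdjoint x)
    (hcomm : ∀ d, x * ρ d = ρ d * x) {d : D} (hd : 0 ≤ d) :
    ‖x‖ * ‖d‖ ≤ ‖x * ρ d‖ := by
  by_contra! hlt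
  have hx0 : 0 < ‖x‖ := by
    by_contra! h
    rw [le_antisymm h (norm_nonneg x), zero_mul] at hlt
    exact (norm_nonneg _).not_gt hlt
  have hcommn : ∀ (n : ℕ) d, x ^ n * ρ d = ρ d * x ^ n := fun n d =>
    (Commute.pow_left (hcomm d) n)
  obtain ⟨q, hq1, hq2⟩ := exists_between ((div_lt_iff₀' hx0).2 hlt)
  have hq0 : 0 < q := lt_of_le_of_lt (by positivity) hq1
  have hq1' : ‖x * ρ d‖ < q * ‖x‖ := (div_lt_iff₀ hx0).1 hq1
  have hρn : ∀ d, ‖ρ d‖ ≤ ‖d‖ := NonUnitalStarAlgHom.norm_apply_le ρ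
  let J : Submodule ℂ D :=
    { carrier := {b | Tendsto (fun k : ℕ => ‖x ^ 2 ^ k * ρ b‖ / ‖x‖ ^ 2 ^ k) atTop (𝓝 0)}
      add_mem' := fun {a b} ha hb => by
        refine squeeze_zero (fun k => by positivity) (fun k => ?_) (by simpa using ha.add hb)
        rw [← add_div, map_add, mul_add]
        gcongr
        exact norm_add_le _ _
      zero_mem' := by simp
      smul_mem' := fun c b hb => by
        have := hb.const_mul ‖c‖
        simpa [norm_smul, mul_div_assoc] using this }
  have hJ : ∀ b, b ∈ J ↔
    Tendsto (fun k : ℕ => ‖x ^ 2 ^ k * ρ b‖ / ‖x‖ ^ 2 ^ k) atTop (𝓝 0) := fun b => Iff.rfl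
  have hJl : ∀ a, ∀ b ∈ J, a * b ∈ J := fun a b hb => by
    rw [hJ] at hb ⊢
    refine squeeze_zero (fun k => by positivity) (fun k => ?_) (by simpa using hb.const_mul ‖a‖)
    rw [← mul_div_assoc, map_mul, ← mul_assoc, hcommn, mul_assoc]
    gcongr
    exact (norm_mul_le _ _).trans (mul_le_mul_of_nonneg_right (hρn a) (norm_nonneg _))
  have hJr : ∀ a, ∀ b ∈ J, b * a ∈ J := fun a b hb => by
    rw [hJ] at hb ⊢
    refine squeeze_zero (fun k => by positivity) (fun k => ?_) (by simpa using hb.mul_const ‖a‖)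
    rw [div_mul_eq_mul_div, map_mul, ← mul_assoc]
    gcongr
    exact (norm_mul_le _ _).trans (mul_le_mul_of_nonneg_left (hρn a) (norm_nonneg _))
  have hJ1 : (1 : D) ∉ J := by
    rw [hJ, hρ]
    intro h
    have : ∀ k : ℕ, ‖x ^ 2 ^ k * 1‖ / ‖x‖ ^ 2 ^ k = 1 := fun k => by
      have e : ‖x ^ 2 ^ k‖ = ‖x‖ ^ 2 ^ k := congrArg NNReal.toReal (hx.nnnorm_pow_two_pow k)
      rw [mul_one, e, div_self (by positivity)]
    simp only [this] at h
    exact one_ne_zero (tendsto_nhds_unique tendsto_const_nhds h)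
  have hspec : ∀ s ∈ spectrum ℝ d, 0 ≤ s := fun s hs => spectrum_nonneg_of_nonneg hd hs
  have hds : IsSelfAdjoint d := .of_nonneg hd
  set b : D := cfc (fun s : ℝ => max 0 (s - q)) d with hb
  have hbJ : b ∈ J := by
    rw [hJ]
    set r : ℝ := ‖x * ρ d‖ / (q * ‖x‖)
    have hr : Tendsto (fun k : ℕ => r ^ 2 ^ k * ‖d‖) atTop (𝓝 0) := by
      have h1 : Tendsto (fun n : ℕ => r ^ n) atTop (𝓝 0) :=
        tendsto_pow_atTop_nhds_zero_of_lt_one (by positivity)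
          ((div_lt_one (by positivity)).2 hq1')
      have h2 : Tendsto (fun k : ℕ => 2 ^ k) atTop atTop :=
        tendsto_pow_atTop_atTop_of_one_lt one_lt_two
      simpa using (h1.comp h2).mul_const ‖d‖
    refine squeeze_zero (fun k => by positivity) (fun k => ?_) hr
    generalize 2 ^ k = n
    have hmax : ∀ s : ℝ, 0 < max s q := fun s => lt_max_of_lt_right hq0
    have hcont : Continuous fun s : ℝ => max 0 (s - q) / (max s q) ^ n :=
      Continuous.div₀ (by fun_prop) (by fun_prop) fun s => (pow_pos (hmax s) n).ne'
    set c : D := cfc (fun s : ℝ => max 0 (s - q) / (max s q) ^ n) d with hc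
    have hbc : b = d ^ n * c := by
      have h2 : d ^ n = cfc (fun s : ℝ => s ^ n) d := by rw [cfc_pow_id d n hds]
      rw [h2, hc, ← cfc_mul _ _ d (by fun_prop) hcont.continuousOn]
      refine cfc_congr fun s hs => ?_
      change max 0 (s - q) = s ^ n * (max 0 (s - q) / max s q ^ n)
      rcases le_total s q with h | h
      · rw [max_eq_left (by linarith : s - q ≤ 0)]; simp
      · have : s ≠ 0 := by linarith
        rw [max_eq_left h]
        field_simp
    have hcn : ‖c‖ ≤ ‖d‖ / q ^ n := by
      refine norm_cfc_le (by positivity) fun s hs => ?_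
      have h0 := hmax s
      rw [Real.norm_of_nonneg (by positivity)]
      have hs' : s ≤ ‖d‖ := by
        have : ‖(1 : D)‖ ≤ 1 := norm_le_one_of_mem_unitary (one_mem _)
        calc s ≤ ‖s‖ := le_abs_self s
          _ ≤ ‖d‖ * ‖(1 : D)‖ := spectrum.norm_le_norm_mul_of_mem hs
          _ ≤ ‖d‖ := mul_le_of_le_one_right (norm_nonneg d) this
      gcongr
      · exact max_le (norm_nonneg d) (by linarith)
      · exact le_max_right _ _
    have hρpow : x ^ n * ρ (d ^ n * c) = (x * ρ d) ^ n * ρ c := by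
      have : ∀ m : ℕ, x ^ m * ρ (d ^ m * c) = (x * ρ d) ^ m * ρ c := by
        intro m
        induction m with
        | zero => simp
        | succ m ih =>
          rw [pow_succ' d, mul_assoc, map_mul, ← mul_assoc, hcommn, mul_assoc, pow_succ',
            mul_assoc, ih, pow_succ' (x * ρ d), hcomm d]
          noncomm_ring
      exact this n
    have hxn : ‖(x * ρ d) ^ n * ρ c‖ ≤ ‖x * ρ d‖ ^ n * (‖d‖ / q ^ n) := by
      refine (norm_mul_le _ _).trans ?_
      rcases n.eq_zero_or_pos with rfl | hn
      · have : ‖(1 : M)‖ ≤ 1 := norm_le_one_of_mem_unitary (one_mem _)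
        rw [pow_zero, pow_zero]
        exact mul_le_mul this ((hρn c).trans hcn) (norm_nonneg _) zero_le_one
      · exact mul_le_mul (norm_pow_le' _ hn) ((hρn c).trans hcn) (norm_nonneg _) (by positivity)
    rw [hbc, hρpow, div_le_iff₀ (by positivity)]
    refine hxn.trans (le_of_eq ?_)
    simp only [r, div_pow, mul_pow]
    field_simp
  have hb0 := hsimple J hJl hJr hJ1 b hbJ
  refine hq2.not_ge ?_
  have e : d = cfc (fun s : ℝ => s - max 0 (s - q)) d := by
    have h := cfc_sub (fun s : ℝ => s) (fun s : ℝ => max 0 (s - q)) d (continuousOn_id' _)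
      (by fun_prop)
    rw [h, ← hb, hb0, sub_zero, cfc_id' ℝ d hds]
  rw [e]
  refine norm_cfc_le hq0.le fun s hs => ?_
  have := hspec s hs
  rw [Real.norm_eq_abs, abs_le]
  constructor <;> rcases max_cases 0 (s - q) with h | h <;> linarith

lemma norm_mul_eq_of_commute
    (hsimple : ∀ J : Submodule ℂ D, (∀ a, ∀ b ∈ J, a * b ∈ J) → (∀ a, ∀ b ∈ J, b * a ∈ J) →
      (1 : D) ∉ J → ∀ b ∈ J, b = 0)
    (ρ : D →⋆ₙₐ[ℂ] M) (hρ : ρ 1 = 1) {x : M} (hcomm : ∀ d, x * ρ d = ρ d * x) (d : D) :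
    ‖x * ρ d‖ = ‖x‖ * ‖d‖ := by
  let _ := CStarAlgebra.spectralOrder D
  let _ := CStarAlgebra.spectralOrderedRing D
  refine le_antisymm ((norm_mul_le _ _).trans (mul_le_mul_of_nonneg_left
    (NonUnitalStarAlgHom.norm_apply_le ρ d) (norm_nonneg x))) ?_
  have hcomm' : ∀ d, star x * ρ d = ρ d * star x := fun d => by
    have := congrArg star (hcomm (star d))
    simpa only [star_mul, map_star, star_star] using this.symm
  have h := norm_mul_le_norm_mul_of_nonneg hsimple ρ hρ (IsSelfAdjoint.star_mul_self x)
    (fun d => by rw [mul_assoc, hcomm, ← mul_assoc, hcomm', mul_assoc]) (star_mul_self_nonneg d)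
  have e : star x * x * ρ (star d * d) = star (x * ρ d) * (x * ρ d) := by
    rw [star_mul, map_mul, map_star, mul_assoc, ← mul_assoc x, ← map_star, hcomm, ← mul_assoc,
      ← mul_assoc, hcomm']
    noncomm_ring
  rw [e, CStarRing.norm_star_mul_self, CStarRing.norm_star_mul_self,
    CStarRing.norm_star_mul_self] at h
  refine abs_le_of_sq_le_sq' (by linarith) (norm_nonneg _) |>.2

end CrossNorm

section ApproximateUnit

variable {A : Type u} [NonUnitalCStarAlgebra A]

/-- A pair of self-adjoint elements suited for approximate units, where `f` acts as a unit
on `e`. -/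
structure IsAlmostIdempotentUnit (e f : A) : Prop where
  star_left : star e = e
  nonneg_right : ∃ c, f = star c * c
  mul_left : f * e = e
  norm_left : ‖e‖ ≤ 2
  norm_right : ‖f‖ ≤ 1

lemma IsAlmostIdempotentUnit.star_right {e f : A} (h : IsAlmostIdempotentUnit e f) :
    star f = f := by
  obtain ⟨c, rfl⟩ := h.nonneg_right
  rw [star_mul, star_star]

lemma IsAlmostIdempotentUnit.mul_right {e f : A} (h : IsAlmostIdempotentUnit e f) :
    e * f = e := by
  have := congrArg star h.mul_left
  rwa [star_mul, h.star_left, h.star_right] at this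

variable (A) in
lemma exists_almostIdempotentUnit : ∃ L : Filter (A × A), L.NeBot ∧
    (∀ᶠ p in L, IsAlmostIdempotentUnit p.1 p.2) ∧
    (∀ a, Tendsto (fun p => p.1 * a) L (𝓝 a)) ∧ ∀ a, Tendsto (fun p => p.2 * a) L (𝓝 a) := by
  let _ := CStarAlgebra.spectralOrder A
  let _ := CStarAlgebra.spectralOrderedRing A
  have hl := CStarAlgebra.increasingApproximateUnit A
  have := hl.neBot
  let g : A × ℝ → A × A := fun q =>
    (cfcₙ (fun s : ℝ => max 0 (s - max 0 q.2)) q.1, cfcₙ (fun s : ℝ => min 1 (s / q.2)) q.1)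
  set L₀ : Filter (A × ℝ) := CStarAlgebra.approximateUnit A ×ˢ 𝓝[>] 0 with hL₀
  have hgood : ∀ᶠ q in L₀, (0 ≤ q.1 ∧ ‖q.1‖ ≤ 1) ∧ 0 < q.2 ∧ q.2 < 1 :=
    (hl.eventually_nonneg.and hl.eventually_norm).prod_mk
      ((eventually_mem_nhdsWithin (a := (0 : ℝ)) (s := Set.Ioi 0)).and
        (eventually_nhdsWithin_of_eventually_nhds (eventually_lt_nhds one_pos)))
  have hdist : ∀ q : A × ℝ, 0 ≤ q.1 → 0 < q.2 → ‖q.1 - (g q).1‖ ≤ q.2 := by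
    rintro ⟨e, δ⟩ (he : 0 ≤ e) (hδ : 0 < δ)
    have hes : IsSelfAdjoint e := .of_nonneg he
    change ‖e - cfcₙ (fun s : ℝ => max 0 (s - max 0 δ)) e‖ ≤ δ
    have h := cfcₙ_sub (fun s : ℝ => s) (fun s : ℝ => max 0 (s - max 0 δ)) e
      (continuousOn_id' _) rfl (by fun_prop) (by simp)
    rw [cfcₙ_id' ℝ e hes] at h
    rw [← h, max_eq_right hδ.le]
    refine norm_cfcₙ_le fun s hs => ?_
    have := quasispectrum_nonneg_of_nonneg e he s hs
    rw [Real.norm_eq_abs, abs_le]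
    constructor <;> rcases max_cases 0 (s - δ) with h | h <;> linarith
  have hunit : ∀ q : A × ℝ, (0 ≤ q.1 ∧ ‖q.1‖ ≤ 1) ∧ 0 < q.2 ∧ q.2 < 1 →
      IsAlmostIdempotentUnit (g q).1 (g q).2 := by
    rintro ⟨e, δ⟩ ⟨⟨he, he1⟩, hδ, hδ1⟩
    have hd := hdist ⟨e, δ⟩ he hδ
    dsimp only at he he1 hδ hδ1 hd
    have hes : IsSelfAdjoint e := .of_nonneg he
    have hs : ∀ s ∈ quasispectrum ℝ e, 0 ≤ s := quasispectrum_nonneg_of_nonneg e he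
    refine ⟨?_, ?_, ?_, ?_, ?_⟩
    · exact (cfcₙ_predicate (R := ℝ) (fun s : ℝ => max 0 (s - max 0 δ)) e).star_eq
    · refine CStarAlgebra.nonneg_iff_eq_star_mul_self.1 (cfcₙ_nonneg fun s hs' => ?_)
      have := hs s hs'
      exact le_min zero_le_one (by positivity)
    · have h := cfcₙ_mul (fun s : ℝ => min 1 (s / δ)) (fun s : ℝ => max 0 (s - max 0 δ)) e
        (by fun_prop) (by simp) (by fun_prop) (by simp)
      refine h.symm.trans (cfcₙ_congr fun s hs' => ?_)
      have := hs s hs'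
      change min 1 (s / δ) * max 0 (s - max 0 δ) = max 0 (s - max 0 δ)
      rw [max_eq_right hδ.le]
      rcases le_total s δ with h | h
      · rw [max_eq_left (sub_nonpos.2 h), mul_zero]
      · rw [min_eq_left ((one_le_div hδ).2 h), one_mul]
    · calc ‖(g (e, δ)).1‖ = ‖e - (e - (g (e, δ)).1)‖ := by rw [sub_sub_cancel]
        _ ≤ ‖e‖ + ‖e - (g (e, δ)).1‖ := norm_sub_le _ _
        _ ≤ 2 := by linarith
    · refine norm_cfcₙ_le fun s hs' => ?_
      have := hs s hs'
      rw [Real.norm_of_nonneg (le_min zero_le_one (by positivity))]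
      exact min_le_left _ _
  have hfst : ∀ a, Tendsto (fun q => (g q).1 * a) L₀ (𝓝 a) := fun a => by
    have h1 : Tendsto (fun q : A × ℝ => q.1 * a) L₀ (𝓝 a) :=
      (hl.tendsto_mul_right a).comp tendsto_fst
    have h2 : Tendsto (fun q : A × ℝ => (q.1 - (g q).1) * a) L₀ (𝓝 0) := by
      have hs : Tendsto (fun q : A × ℝ => q.2 * ‖a‖) L₀ (𝓝 0) := by
        have : Tendsto (fun q : A × ℝ => q.2) L₀ (𝓝 0) :=
          (tendsto_id'.2 nhdsWithin_le_nhds).comp tendsto_snd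
        simpa using this.mul_const ‖a‖
      refine squeeze_zero_norm' ?_ hs
      filter_upwards [hgood] with q hq
      exact (norm_mul_le _ _).trans
        (mul_le_mul_of_nonneg_right (hdist q hq.1.1 hq.2.1) (norm_nonneg a))
    simpa [sub_mul] using h1.sub h2
  refine ⟨L₀.map g, inferInstance, ?_, fun a => tendsto_map'_iff.2 (hfst a),
    fun a => tendsto_map'_iff.2 ?_⟩
  · rw [eventually_map]
    filter_upwards [hgood] with q hq using hunit q hq
  · have h2 : Tendsto (fun q => (g q).2 * (a - (g q).1 * a)) L₀ (𝓝 0) := by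
      refine squeeze_zero_norm' (a := fun q => ‖a - (g q).1 * a‖) ?_ ?_
      · filter_upwards [hgood] with q hq
        exact (norm_mul_le _ _).trans
          (mul_le_of_le_one_left (norm_nonneg _) (hunit q hq).norm_right)
      · simpa using ((hfst a).const_sub a).norm
    have h3 := h2.add (hfst a)
    rw [zero_add] at h3
    refine h3.congr' ?_
    filter_upwards [hgood] with q hq
    rw [Function.comp_apply, mul_sub, ← mul_assoc, (hunit q hq).mul_left, sub_add_cancel]

end ApproximateUnit

namespace CStarTensor

variable {A : Type u} {D : Type v} {T : Type w} [NonUnitalCStarAlgebra A] [CStarAlgebra D]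
  [NonUnitalCStarAlgebra T] (h : CStarTensor A D T)

/-- The elementary tensor as a linear map in the first variable. -/
def tmulLeft (d : D) : A →L[ℂ] T :=
  LinearMap.mkContinuous
    { toFun := fun a => h.tmul a d
      map_add' := fun a a' => h.add_left a a' d
      map_smul' := fun c a => h.smul_left c a d } ‖d‖
    fun a => by simp [h.norm_tmul, mul_comm]

/-- The elementary tensor as a linear map in the second variable. -/
def tmulRight (a : A) : D →L[ℂ] T :=
  LinearMap.mkContinuous
    { toFun := fun d => h.tmul a d
      map_add' := fun d d' => h.add_right a d d'
      map_smul' := fun c d => h.smul_right c a d } ‖a‖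
    fun d => by simp [h.norm_tmul]

lemma continuous_tmul_left (d : D) : Continuous fun a => h.tmul a d := (h.tmulLeft d).continuous

lemma continuous_tmul_right (a : A) : Continuous fun d => h.tmul a d :=
  (h.tmulRight a).continuous

lemma norm_lift_lTensor_le (d : D) (z : A ⊗[ℂ] D) :
    ‖h.lift (LinearMap.lTensor A (LinearMap.mulLeft ℂ d) z)‖ ≤ ‖d‖ * ‖h.lift z‖ := by
  obtain ⟨L, hL, hpair, -, hf⟩ := exists_almostIdempotentUnit A
  have hlim : Tendsto (fun p : A × A => h.tmul p.2 d * h.lift z) L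
      (𝓝 (h.lift (LinearMap.lTensor A (LinearMap.mulLeft ℂ d) z))) := by
    induction z with
    | zero => simp
    | tmul a x =>
      simp only [lift_tmul, h.mul_tmul, LinearMap.lTensor_tmul, LinearMap.mulLeft_apply]
      exact ((h.continuous_tmul_left (d * x)).tendsto a).comp (hf a)
    | add y z hy hz => simpa [mul_add] using hy.add hz
  refine le_of_tendsto hlim.norm ?_
  filter_upwards [hpair] with p hp
  refine (norm_mul_le _ _).trans (mul_le_mul_of_nonneg_right ?_ (norm_nonneg _))
  rw [h.norm_tmul]
  exact mul_le_of_le_one_left (norm_nonneg d) hp.norm_right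

/-- Left multiplication by `1 ⊗ d`. -/
def leftMul (d : D) : T →L[ℂ] T :=
  (h.lift ∘ₗ LinearMap.lTensor A (LinearMap.mulLeft ℂ d)).extendOfNorm h.lift

lemma leftMul_tmul (d : D) (a : A) (x : D) : h.leftMul d (h.tmul a x) = h.tmul a (d * x) := by
  exact LinearMap.extendOfNorm_eq (f := h.lift ∘ₗ LinearMap.lTensor A (LinearMap.mulLeft ℂ d))
    h.denseRange_lift ⟨‖d‖, h.norm_lift_lTensor_le d⟩ (a ⊗ₜ x)

lemma norm_leftMul_le (d : D) (t : T) : ‖h.leftMul d t‖ ≤ ‖d‖ * ‖t‖ :=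
  LinearMap.norm_extendOfNorm_apply_le h.denseRange_lift ‖d‖ (h.norm_lift_lTensor_le d) t

/-- Right multiplication by `1 ⊗ d`. -/
def rightMul (d : D) : T →L[ℂ] T :=
  LinearMap.mkContinuous
    { toFun := fun t => star (h.leftMul (star d) (star t))
      map_add' := fun s t => by simp
      map_smul' := fun c t => by simp } ‖d‖
    fun t => by simpa using h.norm_leftMul_le (star d) (star t)

lemma rightMul_apply (d : D) (t : T) : h.rightMul d t = star (h.leftMul (star d) (star t)) := rfl

lemma rightMul_tmul (d : D) (a : A) (x : D) : h.rightMul d (h.tmul a x) = h.tmul a (x * d) := by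
  rw [rightMul_apply, h.star_tmul, h.leftMul_tmul, h.star_tmul, star_mul, star_star, star_star,
    star_star]

lemma rightMul_mul (d : D) (s t : T) : h.rightMul d s * t = s * h.leftMul d t := by
  refine h.induction_on (p := fun s => h.rightMul d s * t = s * h.leftMul d t)
    (isClosed_eq (by fun_prop) (by fun_prop)) (fun a x => ?_) (fun s s' hs ht => ?_) s
  · refine h.induction_on
      (p := fun t => h.rightMul d (h.tmul a x) * t = h.tmul a x * h.leftMul d t)
      (isClosed_eq (by fun_prop) (by fun_prop)) (fun b y => ?_) (fun t t' ht ht' => ?_) t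
    · rw [rightMul_tmul, leftMul_tmul, h.mul_tmul, h.mul_tmul, mul_assoc]
    · rw [map_add, mul_add, mul_add, ht, ht']
  · rw [map_add, add_mul, add_mul, hs, ht]

/-- Two bounded operators which agree on elementary tensors are equal. -/
lemma clm_ext {f g : T →L[ℂ] T} (hfg : ∀ a x, f (h.tmul a x) = g (h.tmul a x)) : f = g := by
  ext t
  refine h.induction_on (p := fun t => f t = g t) (isClosed_eq (by fun_prop) (by fun_prop)) hfg
    (fun s t hs ht => ?_) t
  rw [map_add, map_add, hs, ht]

/-- The unital embedding `d ↦ 1 ⊗ d` into the multiplier algebra. -/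
def multiplier : D →⋆ₙₐ[ℂ] 𝓜(ℂ, T) where
  toFun d := ⟨(h.leftMul d, h.rightMul d), h.rightMul_mul d⟩
  map_smul' c d := by
    ext : 2 <;> refine h.clm_ext fun a x => ?_
    · simp [leftMul_tmul, h.smul_right]
    · simp [rightMul_tmul, h.smul_right]
  map_zero' := by
    ext : 2 <;> refine h.clm_ext fun a x => ?_
    · simpa [leftMul_tmul] using h.smul_right 0 a 0
    · simpa [rightMul_tmul] using h.smul_right 0 a 0
  map_add' d d' := by
    ext : 2 <;> refine h.clm_ext fun a x => ?_
    · simp [leftMul_tmul, add_mul, h.add_right]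
    · simp [rightMul_tmul, mul_add, h.add_right]
  map_mul' d d' := by
    ext : 2 <;> refine h.clm_ext fun a x => ?_
    · simp [leftMul_tmul, mul_assoc]
    · simp [rightMul_tmul, mul_assoc]
  map_star' d := by
    ext : 2 <;> refine h.clm_ext fun a x => ?_
    · simp [leftMul_tmul, rightMul_tmul, h.star_tmul]
    · simp [leftMul_tmul, rightMul_tmul, h.star_tmul]

@[simp] lemma multiplier_fst (d : D) : (h.multiplier d).fst = h.leftMul d := rfl

@[simp] lemma multiplier_snd (d : D) : (h.multiplier d).snd = h.rightMul d := rfl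

lemma multiplier_one : h.multiplier 1 = 1 := by
  ext : 2 <;> refine h.clm_ext fun a x => ?_
  · simp [leftMul_tmul]
  · simp [rightMul_tmul]

lemma multiplier_mul_tmul (d : D) (a : A) (x : D) :
    h.multiplier d * (h.tmul a x : 𝓜(ℂ, T)) = (h.tmul a (d * x) : 𝓜(ℂ, T)) := by
  rw [DoubleCentralizer.mul_coe_eq, multiplier_fst, leftMul_tmul]

lemma tmul_mul_multiplier (d : D) (a : A) (x : D) :
    (h.tmul a x : 𝓜(ℂ, T)) * h.multiplier d = (h.tmul a (x * d) : 𝓜(ℂ, T)) := by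
  rw [DoubleCentralizer.coe_mul_eq, multiplier_snd, rightMul_tmul]

lemma norm_lift_lTensor_eq {c : ℕ → D} (hc : ∀ n, c n ∈ unitary D) (l : D →⋆ₙₐ[ℂ] D)
    (hl : ∀ d, Tendsto (fun n => star (c n) * d * c n) atTop (𝓝 (l d))) (z : A ⊗[ℂ] D) :
    ‖h.lift (LinearMap.lTensor A (l : D →ₗ[ℂ] D) z)‖ = ‖h.lift z‖ := by
  let ι : T →⋆ₙₐ[ℂ] 𝓜(ℂ, T) := DoubleCentralizer.coeHom
  have hι : ∀ t, ‖ι t‖ = ‖t‖ := DoubleCentralizer.norm_coe_eq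
  have hιc : Continuous ι := ι.continuous_of_cstar
  have hlim : Tendsto (fun n => star (h.multiplier (c n)) * ι (h.lift z) * h.multiplier (c n))
      atTop (𝓝 (ι (h.lift (LinearMap.lTensor A (l : D →ₗ[ℂ] D) z)))) := by
    induction z with
    | zero => simp
    | tmul a x =>
      refine (((hιc.comp (h.continuous_tmul_right a)).tendsto (l x)).comp (hl x)).congr fun n => ?_
      rw [← map_star, lift_tmul]
      change _ = _ * (h.tmul a x : 𝓜(ℂ, T)) * _
      rw [multiplier_mul_tmul, tmul_mul_multiplier]
      rfl
    | add y z hy hz =>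
      simpa only [map_add, mul_add, add_mul] using hy.add hz
  have hu : ∀ n, h.multiplier (c n) ∈ unitary 𝓜(ℂ, T) := fun n => by
    rw [Unitary.mem_iff, ← map_star, ← map_mul, ← map_mul, Unitary.star_mul_self_of_mem (hc n),
      Unitary.mul_star_self_of_mem (hc n), multiplier_one]
    exact ⟨rfl, rfl⟩
  have hn := hlim.norm
  simp only [hι, CStarRing.norm_mul_mem_unitary _ (hu _),
    CStarRing.norm_mem_unitary_mul _ (Unitary.star_mem (hu _))] at hn
  exact tendsto_nhds_unique hn tendsto_const_nhds

end CStarTensor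

section Amplification

lemma CStarTensor.exists_amplification {A : Type u} {D : Type v} {T : Type w}
    [NonUnitalCStarAlgebra A] [CStarAlgebra D] [NonUnitalCStarAlgebra T] (h : CStarTensor A D T)
    {c : ℕ → D} (hc : ∀ n, c n ∈ unitary D) (l : D →⋆ₙₐ[ℂ] D)
    (hl : ∀ d, Tendsto (fun n => star (c n) * d * c n) atTop (𝓝 (l d))) :
    ∃ Λ : T →⋆ₙₐ[ℂ] T, (∀ t, ‖Λ t‖ = ‖t‖) ∧ ∀ a d, Λ (h.tmul a d) = h.tmul a (l d) := by
  set f : A ⊗[ℂ] D →ₗ[ℂ] T := h.lift ∘ₗ LinearMap.lTensor A (l : D →ₗ[ℂ] D) with hf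
  have hnorm : ∀ z, ‖f z‖ = ‖h.lift z‖ := h.norm_lift_lTensor_eq hc l hl
  let L : T →L[ℂ] T := f.extendOfNorm h.lift
  have hLlift : ∀ z, L (h.lift z) = f z := fun z =>
    LinearMap.extendOfNorm_eq h.denseRange_lift ⟨1, fun z => by rw [one_mul, hnorm]⟩ z
  have hL : ∀ a d, L (h.tmul a d) = h.tmul a (l d) := fun a d => hLlift (a ⊗ₜ d)
  have hLn : ∀ t, ‖L t‖ = ‖t‖ := fun t =>
    h.denseRange_lift.induction_on (p := fun t => ‖L t‖ = ‖t‖) t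
      (isClosed_eq (by fun_prop) (by fun_prop)) fun z => by rw [hLlift, hnorm]
  have hmul : ∀ s t, L (s * t) = L s * L t := fun s t => by
    refine h.induction_on (p := fun s => L (s * t) = L s * L t)
      (isClosed_eq (by fun_prop) (by fun_prop)) (fun a x => ?_) (fun s s' hs hs' => ?_) s
    · refine h.induction_on (p := fun t => L (h.tmul a x * t) = L (h.tmul a x) * L t)
        (isClosed_eq (by fun_prop) (by fun_prop)) (fun b y => ?_) (fun t t' ht ht' => ?_) t
      · rw [h.mul_tmul, hL, hL, hL, h.mul_tmul, map_mul]
      · rw [mul_add, map_add, map_add, mul_add, ht, ht']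
    · rw [add_mul, map_add, map_add, add_mul, hs, hs']
  have hstar : ∀ t, L (star t) = star (L t) := fun t => by
    refine h.induction_on (p := fun t => L (star t) = star (L t))
      (isClosed_eq (by fun_prop) (by fun_prop)) (fun a x => ?_) (fun s t hs ht => ?_) t
    · rw [h.star_tmul, hL, hL, h.star_tmul, map_star]
    · rw [star_add, map_add, map_add, star_add, hs, ht]
  let Λ : T →⋆ₙₐ[ℂ] T :=
    { toFun := L
      map_smul' := fun c t => L.map_smul c t
      map_zero' := L.map_zero
      map_add' := L.map_add
      map_mul' := hmul
      map_star' := hstar }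
  exact ⟨Λ, hLn, hL⟩

variable {A D TD T1 T2 : Type u} [NonUnitalCStarAlgebra A] [CStarAlgebra D] [CStarAlgebra TD]
  [NonUnitalCStarAlgebra T1] [NonUnitalCStarAlgebra T2]

/-- If `l` and `ρ` are commuting unital endomorphisms of `D` implementing `D ⊗ D ≅ D`, then
`A ⊗ D` receives the tensor product of `A ⊗ D` and `D`. -/
lemma MinTensor.exists_split (hD : MinTensor D D TD) (hDu : hD.tmul 1 1 = 1)
    (hflip : LocallyConj hD.fst hD.snd) (φ : D ≃⋆ₐ[ℂ] TD) (l ρ : D →⋆ₙₐ[ℂ] D)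
    (hl : ∀ d, φ (l d) = hD.tmul d 1) (hρ : ∀ d, φ (ρ d) = hD.tmul 1 d)
    {c : ℕ → D} (hc : ∀ n, c n ∈ unitary D)
    (hcl : ∀ d, Tendsto (fun n => star (c n) * d * c n) atTop (𝓝 (l d)))
    (h1 : MinTensor A D T1) (h2 : MinTensor T1 D T2) :
    ∃ π : T1 →⋆ₙₐ[ℂ] T2, ∀ a d d', π (h1.tmul a (l d * ρ d')) = h2.tmul (h1.tmul a d) d' := by
  obtain ⟨Λ, hΛn, hΛ⟩ := h1.exists_amplification hc l hcl
  have hlρ : ∀ d d', φ (l d * ρ d') = hD.tmul d d' := fun d d' => by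
    rw [map_mul, hl, hρ, hD.mul_tmul, mul_one, one_mul]
  have hcomm : ∀ d d', l d * ρ d' = ρ d' * l d := fun d d' => EquivLike.injective φ <| by
    rw [hlρ, map_mul, hl, hρ, hD.mul_tmul, mul_one, one_mul]
  have hρ1 : ρ 1 = 1 := EquivLike.injective φ <| by rw [hρ, hDu, map_one]
  let ι : T1 →⋆ₙₐ[ℂ] 𝓜(ℂ, T1) := DoubleCentralizer.coeHom
  have hι : Function.Injective ι := DoubleCentralizer.coe_injective T1
  have hιn : ∀ t, ‖ι t‖ = ‖t‖ := DoubleCentralizer.norm_coe_eq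
  let j : D →⋆ₙₐ[ℂ] 𝓜(ℂ, T1) := h1.multiplier.comp ρ
  have hj1 : j 1 = 1 := by
    change h1.multiplier (ρ 1) = 1
    rw [hρ1, h1.multiplier_one]
  have hιj : ∀ t d, ι t * j d = ι (h1.rightMul (ρ d) t) := fun t d =>
    DoubleCentralizer.coe_mul_eq _ _
  have hjι : ∀ t d, j d * ι t = ι (h1.leftMul (ρ d) t) := fun t d =>
    DoubleCentralizer.mul_coe_eq _ _
  have hcommute : ∀ t d, ι (Λ t) * j d = j d * ι (Λ t) := fun t d => by
    rw [hιj, hjι]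
    have hΛc : Continuous Λ := Λ.continuous_of_cstar
    congr 1
    refine h1.induction_on (p := fun t => h1.rightMul (ρ d) (Λ t) = h1.leftMul (ρ d) (Λ t))
      (isClosed_eq (by fun_prop) (by fun_prop)) (fun a x => ?_) (fun s t hs ht => ?_) t
    · rw [hΛ, h1.rightMul_tmul, h1.leftMul_tmul, hcomm]
    · rw [map_add, map_add, map_add, hs, ht]
  have hsimple := hD.eq_zero_of_mem_ideal hflip
  let h : CStarTensor T1 D T1 :=
    { tmul := fun t d => h1.rightMul (ρ d) (Λ t)
      add_left := fun s t d => by rw [map_add, map_add]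
      add_right := fun t d d' => hι <| by
        rw [map_add ι, ← hιj, ← hιj, ← hιj, map_add, mul_add]
      smul_left := fun c t d => by rw [map_smul, map_smul]
      smul_right := fun c t d => hι <| by
        rw [map_smul ι, ← hιj, ← hιj, map_smul, mul_smul_comm]
      mul_tmul := fun s t d d' => hι <| by
        rw [map_mul ι, ← hιj, ← hιj, ← hιj, map_mul, map_mul, map_mul, mul_assoc, ← mul_assoc (j d),
          ← hcommute, mul_assoc, mul_assoc]
      star_tmul := fun t d => hι <| by
        rw [map_star, ← hιj, ← hιj, star_mul, ← map_star, ← map_star, ← map_star, hcommute]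
      norm_tmul := fun t d => by
        rw [← hιn, ← hιj, norm_mul_eq_of_commute hsimple j hj1 (hcommute t) d, hιn, hΛn]
      dense_span := by
        set S := Submodule.span ℂ {t : T1 | ∃ a b, h1.rightMul (ρ b) (Λ a) = t}
        have hS : ∀ a t, h1.tmul a (φ.symm t) ∈ S.topologicalClosure := fun a t => by
          refine hD.induction_on (p := fun t => h1.tmul a (φ.symm t) ∈ S.topologicalClosure)
            (S.isClosed_topologicalClosure.preimage
              ((h1.continuous_tmul_right a).comp ?_)) (fun d d' => ?_) (fun s t hs ht => ?_) t
          · exact (NonUnitalStarAlgHom.continuous_of_cstar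
              (φ.symm : TD →⋆ₐ[ℂ] D).toNonUnitalStarAlgHom)
          · rw [← hlρ, φ.symm_apply_apply, ← h1.rightMul_tmul, ← hΛ]
            exact S.le_topologicalClosure (Submodule.subset_span ⟨_, _, rfl⟩)
          · rw [map_add, h1.add_right]
            exact add_mem hs ht
        intro t
        refine h1.induction_on (p := fun t => t ∈ S.topologicalClosure)
          S.isClosed_topologicalClosure (fun a d => ?_) (fun s t hs ht => add_mem hs ht) t
        simpa using hS a (φ d) }
  obtain ⟨π, hπ⟩ := h2.minimal T1 h
  refine ⟨π, fun a d d' => ?_⟩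
  rw [← h1.rightMul_tmul, ← hΛ]
  exact hπ (h1.tmul a d) d'

end Amplification

section PartialUnitaries

lemma tendsto_mul_of_eventually_bounded {ι : Type v} {R : Type w} [NonUnitalNormedRing R]
    {L : Filter ι}
    {X z : ι → R} {z₀ z₁ : R} {C : ℝ} (hX : ∀ᶠ i in L, ‖X i‖ ≤ C) (hz : Tendsto z L (𝓝 z₀))
    (h : Tendsto (fun i => X i * z₀) L (𝓝 z₁)) : Tendsto (fun i => X i * z i) L (𝓝 z₁) := by
  have h0 : Tendsto (fun i => X i * (z i - z₀)) L (𝓝 0) := by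
    refine squeeze_zero_norm' (a := fun i => C * ‖z i - z₀‖) ?_ ?_
    · filter_upwards [hX] with i hi
      exact (norm_mul_le _ _).trans (mul_le_mul_of_nonneg_right hi (norm_nonneg _))
    · simpa using (tendsto_iff_norm_sub_tendsto_zero.1 hz).const_mul C
  simpa [mul_sub] using h0.add h

lemma NormedSpace.tendsto_exp_mul {ι : Type v} {R : Type w} [NormedRing R] [NormedAlgebra ℂ R]
    [CompleteSpace R] {L : Filter ι} {y : ι → R} {z : R} {g : ℕ → R} {z₁ : R} {C : ℝ}
    (hy : ∀ᶠ i in L, ‖y i‖ ≤ C) (h : ∀ n, Tendsto (fun i => y i ^ n * z) L (𝓝 (g n)))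
    (hg : HasSum (fun n => (n.factorial : ℂ)⁻¹ • g n) z₁) :
    Tendsto (fun i => NormedSpace.exp (y i) * z) L (𝓝 z₁) := by
  have hexp : ∀ i, NormedSpace.exp (y i) * z = ∑' n, (n.factorial : ℂ)⁻¹ • (y i ^ n * z) :=
    fun i => by
      rw [NormedSpace.exp_eq_tsum ℂ,
        ← (NormedSpace.expSeries_summable' (𝕂 := ℂ) (y i)).tsum_mul_right]
      simp only [smul_mul_assoc]
  simp only [hexp, ← hg.tsum_eq]
  refine tendsto_tsum_of_dominated_convergence (bound := fun n => C ^ n / n.factorial * ‖z‖)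
    ((Real.summable_pow_div_factorial C).mul_right _) (fun n => (h n).const_smul _) ?_
  filter_upwards [hy] with i hi n
  have hpow : ‖y i ^ n * z‖ ≤ C ^ n * ‖z‖ := by
    induction n with
    | zero => simp
    | succ n ih =>
      rw [pow_succ', mul_assoc, pow_succ', mul_assoc]
      exact (norm_mul_le _ _).trans
        (mul_le_mul hi ih (norm_nonneg _) ((norm_nonneg _).trans hi))
  rw [norm_smul, norm_inv, Complex.norm_natCast, div_mul_eq_mul_div, div_eq_inv_mul]
  exact mul_le_mul_of_nonneg_left hpow (by positivity)

/-- `s` is of the form `w r` with `r` positive and `w` a unitary in the unitization which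
acts as the identity on the range of `1 - r`. -/
def HasUnitaryCompletion {T : Type u} [NonUnitalCStarAlgebra T] (s : T) : Prop :=
  ∃ c : T, star c * c * (star c * c) = s * star s ∧
    (s : Unitization ℂ T) + 1 - (star c * c : T) ∈ unitary (Unitization ℂ T)

lemma HasUnitaryCompletion.exists_sqrt {T : Type u} [NonUnitalCStarAlgebra T] {s : T}
    (hs : HasUnitaryCompletion s) : ∃ r : Unitization ℂ T, CStarNonneg r ∧
      r * r = (s : Unitization ℂ T) * star (s : Unitization ℂ T) ∧
      (s : Unitization ℂ T) + 1 - r ∈ unitary (Unitization ℂ T) := by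
  obtain ⟨c, hc, hu⟩ := hs
  refine ⟨_, ⟨(c : Unitization ℂ T), ?_⟩, ?_, hu⟩
  · rw [Unitization.inr_mul, Unitization.inr_star]
  · rw [← Unitization.inr_mul, hc, Unitization.inr_mul, Unitization.inr_star]

lemma HasUnitaryCompletion.map {S : Type u} {T : Type v} [NonUnitalCStarAlgebra S]
    [NonUnitalCStarAlgebra T] {s : S} (hs : HasUnitaryCompletion s) (π : S →⋆ₙₐ[ℂ] T) :
    HasUnitaryCompletion (π s) := by
  obtain ⟨c, hc, hu⟩ := hs
  refine ⟨π c, ?_, ?_⟩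
  · rw [← map_star, ← map_mul, ← map_mul, hc, map_mul, map_star]
  · have := Unitary.map_mem (Unitization.starMap π) hu
    rwa [map_sub, map_add, map_one, Unitization.starMap_inr, Unitization.starMap_inr, map_mul,
      map_star] at this

namespace CStarTensor
variable {A : Type u} {D : Type v} {T : Type w} [NonUnitalCStarAlgebra A] [CStarAlgebra D]
  [NonUnitalCStarAlgebra T] (h : CStarTensor A D T)

/-- The product of the exponentials of `i (e ⊗ k)` in the unitization, for `k` in a list. -/
def expProd (e : A) (l : List (selfAdjoint D)) : Unitization ℂ T :=
  (l.map fun k : selfAdjoint D => NormedSpace.exp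
    (Complex.I • (h.tmul e (k : D) : Unitization ℂ T))).prod

variable {h}

lemma exp_mem_unitary {e : A} (he : star e = e) (k : selfAdjoint D) :
    NormedSpace.exp (Complex.I • (h.tmul e (k : D) : Unitization ℂ T)) ∈
      unitary (Unitization ℂ T) := by
  have hk : star (h.tmul e (k : D) : Unitization ℂ T) = h.tmul e (k : D) := by
    rw [← Unitization.inr_star, h.star_tmul, he, k.2.star_eq]
  rw [← selfAdjoint.expUnitary_coe ⟨(h.tmul e (k : D) : Unitization ℂ T), hk⟩]
  exact SetLike.coe_mem _

lemma expProd_mem_unitary {e : A} (he : star e = e) (l : List (selfAdjoint D)) :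
    h.expProd e l ∈ unitary (Unitization ℂ T) := by
  refine Submonoid.list_prod_mem _ fun y hy => ?_
  obtain ⟨k, -, rfl⟩ := List.mem_map.1 hy
  exact exp_mem_unitary he k

lemma expProd_mul {e f : A} (hef : e * f = e) (l : List (selfAdjoint D)) :
    h.expProd e l * (1 - (h.tmul f 1 : Unitization ℂ T)) = 1 - (h.tmul f 1 : Unitization ℂ T) := by
  induction l with
  | nil => simp [expProd]
  | cons k l ih =>
    have hk : SemiconjBy (1 - (h.tmul f 1 : Unitization ℂ T)) 0
        (Complex.I • (h.tmul e (k : D) : Unitization ℂ T)) := by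
      rw [SemiconjBy, mul_zero, smul_mul_assoc, mul_sub, mul_one, ← Unitization.inr_mul,
        h.mul_tmul, hef, mul_one, sub_self, smul_zero]
    let _ : NormedAlgebra ℚ (Unitization ℂ T) := .restrictScalars ℚ ℂ _
    have := hk.exp_right
    rw [SemiconjBy, NormedSpace.exp_zero, mul_one] at this
    rw [expProd, List.map_cons, List.prod_cons, mul_assoc, ← expProd, ih, ← this]

lemma mul_expProd {e f : A} (hfe : f * e = e) (l : List (selfAdjoint D)) :
    (1 - (h.tmul f 1 : Unitization ℂ T)) * h.expProd e l = 1 - (h.tmul f 1 : Unitization ℂ T) := by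
  induction l with
  | nil => simp [expProd]
  | cons k l ih =>
    have hk : SemiconjBy (1 - (h.tmul f 1 : Unitization ℂ T))
        (Complex.I • (h.tmul e (k : D) : Unitization ℂ T)) 0 := by
      rw [SemiconjBy, zero_mul, mul_smul_comm, sub_mul, one_mul, ← Unitization.inr_mul,
        h.mul_tmul, hfe, one_mul, sub_self, smul_zero]
    let _ : NormedAlgebra ℚ (Unitization ℂ T) := .restrictScalars ℚ ℂ _
    have := hk.exp_right
    rw [SemiconjBy, NormedSpace.exp_zero, one_mul] at this
    rw [expProd, List.map_cons, List.prod_cons, ← mul_assoc, this, ← expProd, ih]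

lemma tendsto_exp_mul_tmul {ι : Type x} {L : Filter ι} {e : ι → A} (hb : ∀ᶠ i in L, ‖e i‖ ≤ 2)
    (he : ∀ a, Tendsto (fun i => e i * a) L (𝓝 a)) (d : D) (a : A) (y : D) :
    Tendsto (fun i => NormedSpace.exp (Complex.I • (h.tmul (e i) d : Unitization ℂ T)) *
      (h.tmul a y : Unitization ℂ T)) L
      (𝓝 (h.tmul a (NormedSpace.exp (Complex.I • d) * y) : Unitization ℂ T)) := by
  have hbd : ∀ᶠ i in L, ‖(Complex.I • (h.tmul (e i) d : Unitization ℂ T))‖ ≤ 2 * ‖d‖ := by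
    filter_upwards [hb] with i hi
    rw [norm_smul, Complex.norm_I, one_mul, Unitization.norm_inr, h.norm_tmul]
    exact mul_le_mul_of_nonneg_right hi (norm_nonneg _)
  have hcont : ∀ y : D, Continuous fun a => (h.tmul a y : Unitization ℂ T) := fun y =>
    Unitization.isometry_inr.continuous.comp (h.continuous_tmul_left y)
  have hstep : ∀ a y, Tendsto (fun i => (Complex.I • (h.tmul (e i) d : Unitization ℂ T)) *
      (h.tmul a y : Unitization ℂ T)) L
      (𝓝 (h.tmul a (Complex.I • d * y) : Unitization ℂ T)) := fun a y => by
    have := ((hcont (Complex.I • d * y)).tendsto a).comp (he a)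
    refine this.congr fun i => ?_
    rw [Function.comp_apply, smul_mul_assoc, smul_mul_assoc, ← Unitization.inr_mul, h.mul_tmul,
      h.smul_right, Unitization.inr_smul]
  refine NormedSpace.tendsto_exp_mul hbd
    (g := fun n => (h.tmul a ((Complex.I • d) ^ n * y) : Unitization ℂ T)) (fun n => ?_) ?_
  · induction n with
    | zero => simpa using tendsto_const_nhds
    | succ n ih =>
      simp only [pow_succ', mul_assoc]
      refine tendsto_mul_of_eventually_bounded hbd ih ?_
      simpa only [mul_assoc] using hstep a ((Complex.I • d) ^ n * y)
  · have hs := (NormedSpace.exp_series_hasSum_exp' (𝕂 := ℂ) (Complex.I • d)).mul_right y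
    have := (hs.mapL (h.tmulRight a)).map (Unitization.inrNonUnitalStarAlgHom ℂ T)
      Unitization.isometry_inr.continuous
    refine HasSum.congr_fun this fun n => ?_
    change _ = (h.tmul a ((n.factorial : ℂ)⁻¹ • (Complex.I • d) ^ n * y) : Unitization ℂ T)
    rw [smul_mul_assoc, h.smul_right, Unitization.inr_smul]

lemma tendsto_expProd_mul_tmul {ι : Type x} {L : Filter ι} {e : ι → A}
    (hs : ∀ᶠ i in L, star (e i) = e i) (hb : ∀ᶠ i in L, ‖e i‖ ≤ 2)
    (he : ∀ a, Tendsto (fun i => e i * a) L (𝓝 a)) (l : List (selfAdjoint D)) (a : A) (y : D) :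
    Tendsto (fun i => h.expProd (e i) l * (h.tmul a y : Unitization ℂ T)) L
      (𝓝 (h.tmul a (((l.map selfAdjoint.expUnitary).prod : unitary D) * y) :
        Unitization ℂ T)) := by
  induction l with
  | nil => simpa [expProd] using tendsto_const_nhds
  | cons k l ih =>
    simp only [expProd, List.map_cons, List.prod_cons, mul_assoc, Submonoid.coe_mul] at ih ⊢
    refine tendsto_mul_of_eventually_bounded (C := 1) ?_ ih ?_
    · filter_upwards [hs] with i hi
      exact norm_le_one_of_mem_unitary (exp_mem_unitary hi k)
    · rw [selfAdjoint.expUnitary_coe]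
      exact tendsto_exp_mul_tmul hb he _ _ _

variable (h) in
/-- A product of exponentials in `D` lifts to a net of contractions in `A ⊗ D` with unitary
completions, converging strictly to `1 ⊗ v`. -/
lemma exists_tendsto_mul_tmul {v : D} {l : List (selfAdjoint D)}
    (hv : ((l.map selfAdjoint.expUnitary).prod : D) = v) : ∃ L : Filter T, L.NeBot ∧
    (∀ᶠ s in L, ‖s‖ ≤ 1 ∧ HasUnitaryCompletion s) ∧
    (∀ a x, Tendsto (fun s => s * h.tmul a x) L (𝓝 (h.tmul a (v * x)))) ∧
    ∀ a x, Tendsto (fun s => star s * h.tmul a x) L (𝓝 (h.tmul a (star v * x))) := by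
  obtain ⟨L, hL, hLp, hLe, hLf⟩ := exists_almostIdempotentUnit A
  let s : A × A → T := fun p =>
    (h.expProd p.1 l * (h.tmul p.2 1 : Unitization ℂ T)).snd
  have hs : ∀ p, (s p : Unitization ℂ T) = h.expProd p.1 l * (h.tmul p.2 1 : Unitization ℂ T) :=
    fun p => Unitization.ext (by simp) (by simp [s])
  have hvu : v ∈ unitary D := hv ▸ SetLike.coe_mem _
  have hstar : ∀ᶠ p in L, star p.1 = p.1 := hLp.mono fun p hp => hp.star_left
  have hunit : ∀ᶠ p in L, h.expProd p.1 l ∈ unitary (Unitization ℂ T) :=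
    hstar.mono fun p hp => expProd_mem_unitary hp l
  have hone : ‖(1 : D)‖ ≤ 1 := norm_le_one_of_mem_unitary (one_mem _)
  have hcontr : ∀ᶠ p in L, ‖(h.tmul p.2 1 : Unitization ℂ T)‖ ≤ 1 := by
    filter_upwards [hLp] with p hp
    rw [Unitization.norm_inr, h.norm_tmul]
    exact mul_le_one₀ hp.norm_right (norm_nonneg _) hone
  have hinr : Continuous ((↑) : T → Unitization ℂ T) := Unitization.isometry_inr.continuous
  have hfmul : ∀ a x, Tendsto (fun p : A × A =>
      (h.tmul p.2 1 : Unitization ℂ T) * (h.tmul a x : Unitization ℂ T)) L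
      (𝓝 (h.tmul a x : Unitization ℂ T)) := fun a x => by
    refine ((hinr.comp (h.continuous_tmul_left x)).tendsto a |>.comp (hLf a)).congr fun p => ?_
    rw [Function.comp_apply, Function.comp_apply, ← Unitization.inr_mul, h.mul_tmul, one_mul]
  have hw : ∀ a x, Tendsto (fun p : A × A => h.expProd p.1 l * (h.tmul a x : Unitization ℂ T)) L
      (𝓝 (h.tmul a (v * x) : Unitization ℂ T)) := fun a x => by
    subst hv
    exact tendsto_expProd_mul_tmul hstar (hLp.mono fun p hp => hp.norm_left) hLe l a x
  have hws : ∀ a x, Tendsto (fun p : A × A =>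
      star (h.expProd p.1 l) * (h.tmul a x : Unitization ℂ T)) L
      (𝓝 (h.tmul a (star v * x) : Unitization ℂ T)) := fun a x => by
    have h0 := hw a (star v * x)
    rw [← mul_assoc, Unitary.mul_star_self_of_mem hvu, one_mul] at h0
    have hx := tendsto_mul_of_eventually_bounded (L := L) (C := 1)
      (X := fun p => star (h.expProd p.1 l))
      (hunit.mono fun p hp => norm_le_one_of_mem_unitary (Unitary.star_mem hp))
      (z := fun p => (h.tmul a x : Unitization ℂ T) -
        h.expProd p.1 l * (h.tmul a (star v * x) : Unitization ℂ T)) (z₀ := 0) (z₁ := 0)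
      (by simpa using h0.const_sub (h.tmul a x : Unitization ℂ T)) (by simp)
    have hy := hx.add_const (h.tmul a (star v * x) : Unitization ℂ T)
    rw [zero_add] at hy
    refine hy.congr' (hunit.mono fun p hp => ?_)
    dsimp only
    rw [mul_sub, ← mul_assoc, Unitary.star_mul_self_of_mem hp, one_mul, sub_add_cancel]
  have hcommute : ∀ᶠ p in L, h.expProd p.1 l * (h.tmul p.2 1 : Unitization ℂ T) =
      (h.tmul p.2 1 : Unitization ℂ T) * h.expProd p.1 l := by
    filter_upwards [hLp] with p hp
    have hq := (h.expProd_mul hp.mul_right l).trans (h.mul_expProd hp.mul_left l).symm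
    rwa [mul_sub, sub_mul, mul_one, one_mul, sub_right_inj] at hq
  refine ⟨L.map s, hL.map s, ?_, fun a x => ?_, fun a x => ?_⟩
  · rw [eventually_map]
    filter_upwards [hLp, hunit, hcontr, hcommute] with p hp hu hc hcm
    refine ⟨?_, ?_⟩
    · rw [← Unitization.norm_inr (𝕜 := ℂ), hs]
      exact (norm_mul_le _ _).trans
        (mul_le_one₀ (norm_le_one_of_mem_unitary hu) (norm_nonneg _) hc)
    · obtain ⟨c, hc⟩ := hp.nonneg_right
      have hfc : star (h.tmul c 1) * h.tmul c 1 = h.tmul p.2 1 := by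
        rw [h.star_tmul, h.mul_tmul, hc, star_one, mul_one]
      refine ⟨h.tmul c 1, ?_, ?_⟩
      · apply Unitization.inr_injective (R := ℂ)
        rw [hfc, Unitization.inr_mul, Unitization.inr_mul, Unitization.inr_star, hs, hcm,
          star_mul, ← mul_assoc, mul_assoc _ (h.expProd p.1 l), Unitary.mul_star_self_of_mem hu,
          mul_one, ← Unitization.inr_star, h.star_tmul, hp.star_right, star_one]
      · rw [hfc, hs]
        have hq := h.expProd_mul hp.mul_right l
        rw [mul_sub, mul_one] at hq
        rw [add_sub_assoc, ← hq, add_sub_cancel]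
        exact hu
  · rw [tendsto_map'_iff,
      (Unitization.isometry_inr (𝕜 := ℂ) (A := T)).isEmbedding.tendsto_nhds_iff]
    refine (tendsto_mul_of_eventually_bounded (hunit.mono fun p => norm_le_one_of_mem_unitary)
      (hfmul a x) (hw a x)).congr fun p => ?_
    simp only [Function.comp_apply, Unitization.inr_mul, hs, mul_assoc]
  · rw [tendsto_map'_iff,
      (Unitization.isometry_inr (𝕜 := ℂ) (A := T)).isEmbedding.tendsto_nhds_iff]
    refine (tendsto_mul_of_eventually_bounded hcontr (hws a x)
      (hfmul a (star v * x))).congr' (hLp.mono fun p hp => ?_)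
    simp only [Function.comp_apply, Unitization.inr_mul, Unitization.inr_star, hs, star_mul,
      mul_assoc]
    rw [← Unitization.inr_star (h.tmul p.2 1), h.star_tmul, hp.star_right, star_one]

end CStarTensor

end PartialUnitaries

section PartialUnitarySequence

lemma tendsto_zero_of_denseRange {X : Type u} {Y : Type v} [SeminormedAddCommGroup X]
    [SeminormedAddCommGroup Y] {f : ℕ → X → Y} {C : ℝ} (hsub : ∀ n x y, f n (x - y) = f n x - f n y)
    (hC : ∀ n x, ‖f n x‖ ≤ C * ‖x‖) {u : ℕ → X} (hu : DenseRange u)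
    (h : ∀ k, Tendsto (fun n => f n (u k)) atTop (𝓝 0)) (x : X) :
    Tendsto (fun n => f n x) atTop (𝓝 0) := by
  rw [Metric.tendsto_nhds]
  intro ε hε
  obtain ⟨k, hk⟩ := hu.exists_dist_lt x (ε := ε / 2 / (|C| + 1)) (by positivity)
  filter_upwards [Metric.tendsto_nhds.1 (h k) (ε / 2) (by positivity)] with n hn
  rw [dist_zero_right] at hn ⊢
  have h1 : ‖f n (x - u k)‖ ≤ ε / 2 := by
    rw [dist_eq_norm, lt_div_iff₀ (by positivity)] at hk
    have := hC n (x - u k)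
    nlinarith [le_abs_self C, norm_nonneg (x - u k)]
  calc ‖f n x‖ = ‖f n (x - u k) + f n (u k)‖ := by rw [hsub, sub_add_cancel]
    _ ≤ ‖f n (x - u k)‖ + ‖f n (u k)‖ := norm_add_le _ _
    _ < ε := by linarith

namespace CStarTensor
variable {A : Type u} {D : Type v} {T : Type w} [NonUnitalCStarAlgebra A] [CStarAlgebra D]
  [NonUnitalCStarAlgebra T] (h : CStarTensor A D T)

lemma exists_partialUnitary {l ρ : D → D}
    (hlρ : ∀ (G : Finset D) (ε : ℝ), 0 < ε → ∃ (v : D) (k : List (selfAdjoint D)),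
      ((k.map selfAdjoint.expUnitary).prod : D) = v ∧ ∀ d ∈ G, ‖star v * ρ d * v - l d‖ < ε)
    (F : Finset A) (G : Finset D) {ε : ℝ} (hε : 0 < ε) :
    ∃ s : T, ‖s‖ ≤ 1 ∧ HasUnitaryCompletion s ∧ ∀ a ∈ F,
      ‖s * h.tmul a 1 - h.tmul a 1 * s‖ < ε ∧
      ‖star s * s * h.tmul a 1 - h.tmul a 1‖ < ε ∧
      ∀ d ∈ G, ‖star s * h.tmul a (ρ d) * s - h.tmul a (l d)‖ < ε := by
  set M := ∑ a ∈ F, ‖a‖ with hM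
  have hM0 : 0 ≤ M := Finset.sum_nonneg fun a _ => norm_nonneg a
  obtain ⟨v, k, hk, hv⟩ := hlρ G (ε / (M + 1)) (by positivity)
  have hvu : v ∈ unitary D := hk ▸ SetLike.coe_mem _
  obtain ⟨L, hL, hs, hleft, hstar⟩ := h.exists_tendsto_mul_tmul hk
  have hstar1 : ∀ᶠ s in L, ‖star s‖ ≤ 1 := hs.mono fun s hs => (norm_star s).trans_le hs.1
  have hright : ∀ a x, Tendsto (fun s => h.tmul a x * s) L (𝓝 (h.tmul a (x * v))) := fun a x => by
    have := (hstar (star a) (star x)).star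
    simpa only [star_mul, h.star_tmul, star_star] using this
  have hconj : ∀ a x, Tendsto (fun s => star s * h.tmul a x * s) L
      (𝓝 (h.tmul a (star v * x * v))) := fun a x => by
    simpa only [mul_assoc] using
      tendsto_mul_of_eventually_bounded hstar1 (hright a x) (hstar a (x * v))
  have hcomm : ∀ a, Tendsto (fun s => ‖s * h.tmul a 1 - h.tmul a 1 * s‖) L (𝓝 0) := fun a => by
    simpa using ((hleft a 1).sub (hright a 1)).norm
  have hss : ∀ a, Tendsto (fun s => ‖star s * s * h.tmul a 1 - h.tmul a 1‖) L (𝓝 0) := fun a => by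
    have := tendsto_mul_of_eventually_bounded hstar1 (hleft a 1) (hstar a (v * 1))
    rw [mul_one, Unitary.star_mul_self_of_mem hvu] at this
    simpa [mul_assoc] using (this.sub_const (h.tmul a 1)).norm
  have hcl : ∀ a ∈ F, ∀ d ∈ G, ∀ᶠ s in L,
      ‖star s * h.tmul a (ρ d) * s - h.tmul a (l d)‖ < ε := fun a ha d hd => by
    refine ((hconj a (ρ d)).sub_const (h.tmul a (l d))).norm.eventually_lt_const ?_
    have hsub : h.tmul a (star v * ρ d * v) - h.tmul a (l d) =
        h.tmul a (star v * ρ d * v - l d) := ((h.tmulRight a).map_sub _ _).symm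
    rw [hsub, h.norm_tmul]
    have haM : ‖a‖ ≤ M := Finset.single_le_sum (f := fun a => ‖a‖) (fun a _ => norm_nonneg a) ha
    calc ‖a‖ * ‖star v * ρ d * v - l d‖ ≤ M * (ε / (M + 1)) :=
          mul_le_mul haM (hv d hd).le (norm_nonneg _) hM0
      _ < ε := by
          rw [mul_div_assoc', div_lt_iff₀ (by positivity)]
          nlinarith
  have hall : ∀ᶠ s in L, ∀ a ∈ F,
      ‖s * h.tmul a 1 - h.tmul a 1 * s‖ < ε ∧
      ‖star s * s * h.tmul a 1 - h.tmul a 1‖ < ε ∧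
      ∀ d ∈ G, ‖star s * h.tmul a (ρ d) * s - h.tmul a (l d)‖ < ε := by
    refine (eventually_all_finset F).2 fun a ha => ?_
    exact ((hcomm a).eventually_lt_const hε).and <| ((hss a).eventually_lt_const hε).and <|
      (eventually_all_finset G).2 fun d hd => hcl a ha d hd
  obtain ⟨s, ⟨hs1, hsu⟩, hsa⟩ := (hs.and hall).exists
  exact ⟨s, hs1, hsu, hsa⟩

lemma exists_partialUnitary_seq [TopologicalSpace.SeparableSpace A]
    [TopologicalSpace.SeparableSpace D] {l ρ : D →⋆ₙₐ[ℂ] D}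
    (hlρ : ∀ (G : Finset D) (ε : ℝ), 0 < ε → ∃ (v : D) (k : List (selfAdjoint D)),
      ((k.map selfAdjoint.expUnitary).prod : D) = v ∧ ∀ d ∈ G, ‖star v * ρ d * v - l d‖ < ε) :
    ∃ s : ℕ → T, (∀ n, ‖s n‖ ≤ 1) ∧ (∀ n, HasUnitaryCompletion (s n)) ∧
      (∀ a, Tendsto (fun n => s n * h.tmul a 1 - h.tmul a 1 * s n) atTop (𝓝 0)) ∧
      (∀ a d, Tendsto (fun n => star (s n) * h.tmul a (ρ d) * s n - h.tmul a (l d))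
        atTop (𝓝 0)) ∧
      ∀ a, Tendsto (fun n => star (s n) * s n * h.tmul a 1 - h.tmul a 1) atTop (𝓝 0) := by
  classical
  set α := TopologicalSpace.denseSeq A
  set δ := TopologicalSpace.denseSeq D
  have hα : DenseRange α := TopologicalSpace.denseRange_denseSeq A
  have hδ : DenseRange δ := TopologicalSpace.denseRange_denseSeq D
  choose s hs hsu hsa using fun n : ℕ => h.exists_partialUnitary hlρ
    ((Finset.range (n + 1)).image α) ((Finset.range (n + 1)).image δ)
    (ε := 1 / ((n : ℝ) + 1)) (by positivity)
  have hmemα : ∀ k n, k ≤ n → α k ∈ (Finset.range (n + 1)).image α := fun k n hkn =>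
    Finset.mem_image_of_mem _ (Finset.mem_range.2 (by lia))
  have hmemδ : ∀ k n, k ≤ n → δ k ∈ (Finset.range (n + 1)).image δ := fun k n hkn =>
    Finset.mem_image_of_mem _ (Finset.mem_range.2 (by lia))
  have hlim : ∀ {f : ℕ → T} (k : ℕ), (∀ n, k ≤ n → ‖f n‖ < 1 / ((n : ℝ) + 1)) →
      Tendsto f atTop (𝓝 0) := fun k hf =>
    squeeze_zero_norm' ((eventually_ge_atTop k).mono fun n hn => (hf n hn).le)
      tendsto_one_div_add_atTop_nhds_zero_nat
  have hone : ‖(1 : D)‖ ≤ 1 := norm_le_one_of_mem_unitary (one_mem _)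
  have htmul1 : ∀ a, ‖h.tmul a 1‖ ≤ ‖a‖ := fun a => by
    rw [h.norm_tmul]
    exact mul_le_of_le_one_right (norm_nonneg _) hone
  have hsub_left : ∀ a b d, h.tmul (a - b) d = h.tmul a d - h.tmul b d := fun a b d =>
    (h.tmulLeft d).map_sub a b
  have hsub_right : ∀ a d e, h.tmul a (d - e) = h.tmul a d - h.tmul a e := fun a d e =>
    (h.tmulRight a).map_sub d e
  have hmul_left : ∀ n t, ‖s n * t‖ ≤ ‖t‖ := fun n t =>
    (norm_mul_le _ _).trans (mul_le_of_le_one_left (norm_nonneg _) (hs n))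
  have hmul_right : ∀ n t, ‖t * s n‖ ≤ ‖t‖ := fun n t =>
    (norm_mul_le _ _).trans (mul_le_of_le_one_right (norm_nonneg _) (hs n))
  have hstar_left : ∀ n t, ‖star (s n) * t‖ ≤ ‖t‖ := fun n t =>
    (norm_mul_le _ _).trans
      (mul_le_of_le_one_left (norm_nonneg _) ((norm_star _).trans_le (hs n)))
  have hbound : ∀ n a d, ‖star (s n) * h.tmul a (ρ d) * s n - h.tmul a (l d)‖ ≤
      2 * ‖a‖ * ‖d‖ := fun n a d => by
    have h1 : ‖h.tmul a (ρ d)‖ ≤ ‖a‖ * ‖d‖ := by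
      rw [h.norm_tmul]
      exact mul_le_mul_of_nonneg_left (NonUnitalStarAlgHom.norm_apply_le ρ d) (norm_nonneg _)
    have h2 : ‖h.tmul a (l d)‖ ≤ ‖a‖ * ‖d‖ := by
      rw [h.norm_tmul]
      exact mul_le_mul_of_nonneg_left (NonUnitalStarAlgHom.norm_apply_le l d) (norm_nonneg _)
    have h3 := (hmul_right n (star (s n) * h.tmul a (ρ d))).trans (hstar_left n _)
    linarith [norm_sub_le (star (s n) * h.tmul a (ρ d) * s n) (h.tmul a (l d))]
  refine ⟨s, hs, hsu, ?_, fun a d => ?_, ?_⟩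
  · refine tendsto_zero_of_denseRange (C := 2) (fun n a b => ?_) (fun n a => ?_) hα fun k =>
      hlim k fun n hn => (hsa n _ (hmemα k n hn)).1
    · rw [hsub_left, mul_sub, sub_mul]
      abel
    · linarith [norm_sub_le (s n * h.tmul a 1) (h.tmul a 1 * s n), hmul_left n (h.tmul a 1),
        hmul_right n (h.tmul a 1), htmul1 a]
  · refine tendsto_zero_of_denseRange (C := 2 * ‖a‖)
      (f := fun n d => star (s n) * h.tmul a (ρ d) * s n - h.tmul a (l d))
      (fun n d e => ?_) (fun n d => hbound n a d) hδ (fun j => ?_) d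
    · rw [map_sub, map_sub, hsub_right, hsub_right, mul_sub, sub_mul]
      abel
    · refine tendsto_zero_of_denseRange (C := 2 * ‖δ j‖)
        (f := fun n a => star (s n) * h.tmul a (ρ (δ j)) * s n - h.tmul a (l (δ j)))
        (fun n a b => ?_) (fun n a => ?_) hα (fun k => ?_) a
      · rw [hsub_left, hsub_left, mul_sub, sub_mul]
        abel
      · linarith [hbound n a (δ j)]
      · exact hlim (max k j) fun n hn => (hsa n _ (hmemα k n ((le_max_left _ _).trans hn))).2.2 _
          (hmemδ j n ((le_max_right _ _).trans hn))
  · refine tendsto_zero_of_denseRange (C := 2) (fun n a b => ?_) (fun n a => ?_) hα fun k =>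
      hlim k fun n hn => (hsa n _ (hmemα k n hn)).2.1
    · rw [hsub_left, mul_sub]
      abel
    · have h3 := (hstar_left n (s n * h.tmul a 1)).trans (hmul_left n _)
      rw [← mul_assoc] at h3
      linarith [norm_sub_le (star (s n) * s n * h.tmul a 1) (h.tmul a 1), htmul1 a]

end CStarTensor

end PartialUnitarySequence

section Factors
variable {D : Type u} {E : Type v} {T : Type w} [CStarAlgebra D] [CStarAlgebra E] [CStarAlgebra T]

/-- The first factor embedding `MinTensor.fst` as a ⋆-homomorphism. -/
def MinTensor.fstHom (h : MinTensor D E T) : D →⋆ₙₐ[ℂ] T where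
  toFun := h.fst
  map_smul' c d := h.smul_left c d 1
  map_zero' := h.zero_tmul 1
  map_add' d d' := h.add_left d d' 1
  map_mul' d d' := by simp only [MinTensor.fst, h.mul_tmul, mul_one]
  map_star' d := by simp only [MinTensor.fst, h.star_tmul, star_one]

/-- The second factor embedding `MinTensor.snd` as a ⋆-homomorphism. -/
def MinTensor.sndHom (h : MinTensor D E T) : E →⋆ₙₐ[ℂ] T where
  toFun := h.snd
  map_smul' c d := h.smul_right c 1 d
  map_zero' := (h.tmulRight 1).map_zero
  map_add' d d' := h.add_right 1 d d'
  map_mul' d d' := by simp only [MinTensor.snd, h.mul_tmul, mul_one]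
  map_star' d := by simp only [MinTensor.snd, h.star_tmul, star_one]

end Factors

/-- Let `A` and `D` be separable C*-algebras with `D` unital, strongly self-absorbing and
`K₁`-injective, and realize `A ⊗ D ⊗ D` as `T2 ≅ (A ⊗ D) ⊗ D` with `T1 ≅ A ⊗ D`.  Then
there is a sequence of contractions `sₙ ∈ A ⊗ D ⊗ D` which asymptotically commutes with
`A ⊗ 1 ⊗ 1`, asymptotically conjugates `a ⊗ 1 ⊗ d` to `a ⊗ d ⊗ 1`, with `sₙ*sₙ`
asymptotically the identity on `A ⊗ 1 ⊗ 1`, and such that `sₙ + 1 − (sₙsₙ*)^{1/2}` is a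
unitary in the unitization `(A ⊗ D ⊗ D)⁺`. -/
theorem stmt_11 {A : Type u} {D : Type u} {TD T1 T2 : Type u}
    [NonUnitalCStarAlgebra A] [CStarAlgebra D] [CStarAlgebra TD]
    [NonUnitalCStarAlgebra T1] [NonUnitalCStarAlgebra T2]
    [TopologicalSpace.SeparableSpace A] [TopologicalSpace.SeparableSpace D]
    (hD : MinTensor D D TD) (hDu : hD.tmul 1 1 = 1)
    (hssa : IsStronglySelfAbsorbing hD) (hK1 : K1Injective D)
    (h1 : MinTensor A D T1) (h2 : MinTensor T1 D T2) :
    ∃ s : ℕ → T2, (∀ n, ‖s n‖ ≤ 1) ∧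
      -- (i) asymptotically central for `A ⊗ 1 ⊗ 1`
      (∀ a : A, Tendsto (fun n =>
          ‖s n * h2.tmul (h1.tmul a 1) 1 - h2.tmul (h1.tmul a 1) 1 * s n‖)
        atTop (𝓝 (0 : ℝ))) ∧
      -- (ii) `sₙ* (a ⊗ 1 ⊗ d) sₙ → a ⊗ d ⊗ 1`
      (∀ (a : A) (d : D), Tendsto (fun n =>
          ‖star (s n) * h2.tmul (h1.tmul a 1) d * s n - h2.tmul (h1.tmul a d) 1‖)
        atTop (𝓝 (0 : ℝ))) ∧
      -- (iii) `sₙ*sₙ (a ⊗ 1 ⊗ 1) → a ⊗ 1 ⊗ 1`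
      (∀ a : A, Tendsto (fun n =>
          ‖star (s n) * s n * h2.tmul (h1.tmul a 1) 1 - h2.tmul (h1.tmul a 1) 1‖)
        atTop (𝓝 (0 : ℝ))) ∧
      -- (iv) `sₙ + 1 − (sₙ sₙ*)^{1/2}` is a unitary in the unitization, where the square
      -- root is the (unique) positive square root of `sₙ sₙ*`
      (∀ n, ∃ r : Unitization ℂ T2, CStarNonneg r ∧
        r * r = (s n : Unitization ℂ T2) * star (s n : Unitization ℂ T2) ∧
        (s n : Unitization ℂ T2) + 1 - r ∈ unitary (Unitization ℂ T2)) := by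
  obtain ⟨φ, hφ, hρl⟩ := hssa.exists_locallyConj hDu
  let φ' : D →⋆ₙₐ[ℂ] TD := (φ : D →⋆ₐ[ℂ] TD).toNonUnitalStarAlgHom
  let ψ : TD →⋆ₙₐ[ℂ] D := (φ.symm : TD →⋆ₐ[ℂ] D).toNonUnitalStarAlgHom
  have hφψ : ∀ t, φ' (ψ t) = t := φ.apply_symm_apply
  have hψφ : ∀ d, ψ (φ' d) = d := φ.symm_apply_apply
  have hφ1 : φ' 1 = 1 := map_one φ
  have hψ1 : ψ 1 = 1 := map_one φ.symm
  let l : D →⋆ₙₐ[ℂ] D := ψ.comp hD.fstHom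
  let ρ : D →⋆ₙₐ[ℂ] D := ψ.comp hD.sndHom
  have hl : ∀ d, φ (l d) = hD.tmul d 1 := fun d => hφψ _
  have hρ : ∀ d, φ (ρ d) = hD.tmul 1 d := fun d => hφψ _
  have hflip : LocallyConj hD.fst hD.snd := by
    have := (hρl.comp_left φ' hφ1).symm
    rwa [← Function.comp_assoc, ← Function.comp_assoc, show (φ' : D → TD) ∘ φ.symm = id from
      funext hφψ, Function.id_comp, Function.id_comp] at this
  have hidl : LocallyConj (id : D → D) l := by
    have := hφ.locallyConj.comp_left ψ hψ1
    rwa [show (ψ : TD → D) ∘ φ = id from funext hψφ] at this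
  obtain ⟨c, hc, hcl⟩ := hφ.exists_unitary
  have hψc : ∀ n, ψ (c n) ∈ unitary D := fun n => Unitary.map_mem φ.symm (hc n)
  have hψcl : ∀ d, Tendsto (fun n => star (ψ (c n)) * d * ψ (c n)) atTop (𝓝 (l d)) := fun d => by
    refine ((ψ.continuous_of_cstar.tendsto _).comp (hcl d)).congr fun n => ?_
    rw [Function.comp_apply, map_mul, map_mul, map_star]
    congr 2
    exact hψφ d
  have hcomm : ∀ d e, l d * ρ e = ρ e * l d := fun d e => EquivLike.injective φ <| by
    rw [map_mul, map_mul, hl, hρ, hD.mul_tmul, hD.mul_tmul, one_mul, mul_one, one_mul, mul_one]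
  have hl1 : l 1 = 1 := EquivLike.injective φ <| by rw [hl, hDu, map_one]
  have hρ1 : ρ 1 = 1 := EquivLike.injective φ <| by rw [hρ, hDu, map_one]
  obtain ⟨π, hπ⟩ := hD.exists_split hDu hflip φ l ρ hl hρ hψc hψcl h1 h2
  have hπl : ∀ a d, π (h1.tmul a (l d)) = h2.tmul (h1.tmul a d) 1 := fun a d => by
    rw [← hπ, hρ1, mul_one]
  have hπρ : ∀ a d, π (h1.tmul a (ρ d)) = h2.tmul (h1.tmul a 1) d := fun a d => by
    rw [← hπ, hl1, one_mul]
  have hπ1 : ∀ a, π (h1.tmul a 1) = h2.tmul (h1.tmul a 1) 1 := fun a => by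
    rw [← hπl, hl1]
  obtain ⟨s, hs, hsu, hsa, hsl, hss⟩ := h1.exists_partialUnitary_seq (l := l) (ρ := ρ)
    fun G ε hε => by
      obtain ⟨u, hu, x, hx, hG⟩ := LocallyConj.exists_commutator hcomm hidl hρl G hε
      obtain ⟨k, hk⟩ := hK1.exists_exp_of_commutator hu hx
      exact ⟨_, k, hk, hG⟩
  have hπnorm : ∀ {f : ℕ → T1}, Tendsto f atTop (𝓝 0) →
      Tendsto (fun n => ‖π (f n)‖) atTop (𝓝 0) := fun hf => by
    simpa using ((π.continuous_of_cstar.tendsto _).comp hf).norm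
  refine ⟨fun n => π (s n), fun n => (NonUnitalStarAlgHom.norm_apply_le π _).trans (hs n),
    fun a => ?_, fun a d => ?_, fun a => ?_, fun n => ((hsu n).map π).exists_sqrt⟩
  · simpa only [map_sub, map_mul, map_star, hπ1] using hπnorm (hsa a)
  · simpa only [map_sub, map_mul, map_star, hπl, hπρ] using hπnorm (hsl a d)
  · simpa only [map_sub, map_mul, map_star, hπ1] using hπnorm (hss a)
end
end

section
/- Let A and B be separable C*-algebras and ι : A → B an embedding. Suppose there is a sequence of unitaries vₙ in Q(B⁺) such that for all a ∈ A and b ∈ B one has ‖[vₙ, ι(a)]‖ → 0 and dist(vₙ* b vₙ, Q(ι(A))) → 0. Then there is an isomorphism ψ : A → B which is approximately unitarily equivalent to ι. -/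
open scoped MultiplierAlgebra TensorProduct
open Filter Topology

noncomputable section

universe u v w x

/-- The *-subalgebra `∏_ℕ A` of bounded sequences inside `ℕ → A`. -/
def boundedSeqs (A : Type u) [NonUnitalCStarAlgebra A] :
    NonUnitalStarSubalgebra ℂ (ℕ → A) where
  carrier := {f | ∃ C, ∀ n, ‖f n‖ ≤ C}
  add_mem' := by
    rintro f g ⟨C, hC⟩ ⟨D, hD⟩
    exact ⟨C + D, fun n => (norm_add_le _ _).trans (add_le_add (hC n) (hD n))⟩
  zero_mem' := ⟨0, fun n => by simp⟩
  mul_mem' := by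
    rintro f g ⟨C, hC⟩ ⟨D, hD⟩
    refine ⟨C * D, fun n => (norm_mul_le _ _).trans ?_⟩
    exact mul_le_mul (hC n) (hD n) (norm_nonneg _) ((norm_nonneg (f n)).trans (hC n))
  smul_mem' := by
    rintro c f ⟨C, hC⟩
    exact ⟨‖c‖ * C, fun n => by
      rw [Pi.smul_apply, norm_smul]
      exact mul_le_mul_of_nonneg_left (hC n) (norm_nonneg c)⟩
  star_mem' := by
    rintro f ⟨C, hC⟩
    exact ⟨C, fun n => by simpa using hC n⟩

/-- The constant sequence, as a bounded sequence. -/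
def constSeq {A : Type u} [NonUnitalCStarAlgebra A] (a : A) : boundedSeqs A :=
  ⟨fun _ => a, ⟨‖a‖, fun _ => le_rfl⟩⟩

/-- Data exhibiting `QA` as the sequence algebra `Q(A) = (∏_ℕ A) / (⊕_ℕ A)`: a surjective
*-homomorphism from the algebra of bounded sequences whose kernel is exactly the ideal of
sequences converging to zero in norm. -/
structure IsSeqCorona (A : Type u) [NonUnitalCStarAlgebra A] (QA : Type v)
    [NonUnitalCStarAlgebra QA] where
  q : boundedSeqs A →⋆ₙₐ[ℂ] QA
  surjective : Function.Surjective q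
  ker_iff : ∀ f : boundedSeqs A,
    q f = 0 ↔ Tendsto (fun n => ‖(f : ℕ → A) n‖) atTop (𝓝 (0 : ℝ))

/-- The canonical embedding `A → Q(A)` via constant sequences. -/
def IsSeqCorona.incl {A : Type u} [NonUnitalCStarAlgebra A] {QA : Type v}
    [NonUnitalCStarAlgebra QA] (h : IsSeqCorona A QA) : A → QA :=
  fun a => h.q (constSeq a)

section Corona

open scoped CStarAlgebra

variable {C D Q : Type*} [CStarAlgebra C] [CStarAlgebra D] [CStarAlgebra Q]
  {p : C →⋆ₐ[ℂ] Q} {ev : ℕ → C →⋆ₐ[ℂ] D}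

/-- If the kernel of `p` consists of null sequences, the norm of `p g` bounds the limit superior of
the norms of the entries of `g`. -/
theorem eventually_norm_lt_of_norm_map_lt
    (hker : ∀ g, p g = 0 → Tendsto (fun k => ‖ev k g‖) atTop (𝓝 0))
    {g : C} {ε : ℝ} (hg : ‖p g‖ < ε) : ∀ᶠ k in atTop, ‖ev k g‖ < ε := by
  have hp : Continuous p := map_continuous p
  set h : C := star g * g with hh
  have hsa : IsSelfAdjoint h := .star_mul_self g
  have hpsa : IsSelfAdjoint (p h) := hsa.map p
  set r : ℝ := ‖p g‖ ^ 2 with hr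
  have hr0 : 0 ≤ r := sq_nonneg _
  have hph : ‖p h‖ = r := by
    rw [hh, map_mul, map_star, CStarRing.norm_star_mul_self, hr, sq]
  let f : ℝ → ℝ := fun t => max (t - r) 0
  have hf : Continuous f := by fun_prop
  have hzero : p (cfc f h) = 0 := by
    rw [StarAlgHomClass.map_cfc p f h hf.continuousOn hp hsa hpsa]
    rcases subsingleton_or_nontrivial Q with _ | _
    · exact Subsingleton.elim _ _
    rw [cfc_congr (g := fun _ => (0 : ℝ)), cfc_const_zero]
    intro t ht
    have := (le_abs_self t).trans (spectrum.norm_le_norm_of_mem ht)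
    exact max_eq_right (by linarith)
  have hnorm : ‖h - cfc f h‖ ≤ r := by
    have : h - cfc f h = cfc (fun t : ℝ => t - f t) h := by
      rw [cfc_sub (fun t : ℝ => t) f h (by fun_prop) hf.continuousOn, cfc_id' ℝ h]
    rw [this]
    refine norm_cfc_le hr0 fun t ht => ?_
    have ht0 : 0 ≤ t := spectrum_star_mul_self_nonneg t ht
    rw [Real.norm_eq_abs, abs_le]
    rcases max_cases (t - r) 0 with ⟨h1, h2⟩ | ⟨h1, h2⟩ <;> simp only [f, h1] <;>
      constructor <;> linarith
  have hlim := hker _ hzero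
  have hεr : 0 < ε ^ 2 - r := by
    have : ‖p g‖ ^ 2 < ε ^ 2 := pow_lt_pow_left₀ hg (norm_nonneg _) two_ne_zero
    linarith
  filter_upwards [hlim.eventually (gt_mem_nhds hεr)] with k hk
  have h1 : ‖ev k h‖ ≤ r + ‖ev k (cfc f h)‖ := by
    have h2 : ‖ev k (h - cfc f h)‖ ≤ r := (NonUnitalStarAlgHom.norm_apply_le (ev k) _).trans hnorm
    have h3 : ev k h = ev k (h - cfc f h) + ev k (cfc f h) := by simp
    rw [h3]
    exact (norm_add_le _ _).trans (by gcongr)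
  have h4 : ‖ev k h‖ = ‖ev k g‖ ^ 2 := by
    rw [hh, map_mul, map_star, CStarRing.norm_star_mul_self, sq]
  have h5 : ‖ev k g‖ ^ 2 < ε ^ 2 := by linarith
  exact lt_of_pow_lt_pow_left₀ 2 ((norm_nonneg _).trans hg.le) h5

/-- Unitaries lift, along a surjection whose kernel consists of null sequences, to sequences that
are eventually unitary. -/
theorem exists_eventually_mem_unitary_lift (hsurj : Function.Surjective p)
    (hker : ∀ g, p g = 0 → Tendsto (fun k => ‖ev k g‖) atTop (𝓝 0))
    {w : Q} (hw : w ∈ unitary Q) :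
    ∃ u : C, p u = w ∧ ∀ᶠ k in atTop, ev k u ∈ unitary D := by
  have hp : Continuous p := map_continuous p
  obtain ⟨g, hg⟩ := hsurj w
  set h : C := star g * g with hh
  have hsa : IsSelfAdjoint h := .star_mul_self g
  have hph : p h = 1 := by
    rw [hh, map_mul, map_star, hg, Unitary.star_mul_self_of_mem hw]
  let φ : ℝ → ℝ := fun t => (√(max t (1 / 2)))⁻¹
  have hφ : Continuous φ := by
    refine Continuous.inv₀ (by fun_prop) fun t => (Real.sqrt_pos.2 ?_).ne'
    exact lt_max_of_lt_right (by norm_num)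
  have hφ1 : φ 1 = 1 := by norm_num [φ]
  set c : C := cfc φ h with hc
  have hcsa : IsSelfAdjoint c := cfc_predicate φ h
  have hpc : p c = 1 := by
    rw [hc, StarAlgHomClass.map_cfc p φ h hφ.continuousOn hp hsa (hsa.map p), hph,
      cfc_apply_one, hφ1, map_one]
  have hpu : p (g * c) = w := by rw [map_mul, hg, hpc, mul_one]
  have hstar : star (g * c) * (g * c) - 1 = cfc (fun t => φ t * t * φ t - 1) h := by
    rw [cfc_sub (fun t : ℝ => φ t * t * φ t) (fun _ => 1) h (by fun_prop) (by fun_prop),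
      cfc_mul (fun t : ℝ => φ t * t) φ h (by fun_prop) (by fun_prop),
      cfc_mul φ (fun t : ℝ => t) h (by fun_prop) (by fun_prop), cfc_id' ℝ h,
      cfc_const_one ℝ h, ← hc, star_mul, hcsa.star_eq, hh]
    simp only [mul_assoc]
  have hlim1 : Tendsto (fun k => ‖ev k (h - 1)‖) atTop (𝓝 0) := hker _ (by simp [hph])
  have hlim2 : Tendsto (fun k => ‖ev k ((g * c) * star (g * c) - 1)‖) atTop (𝓝 0) :=
    hker _ (by rw [map_sub, map_mul, map_star, hpu, map_one, Unitary.mul_star_self_of_mem hw,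
      sub_self])
  refine ⟨g * c, hpu, ?_⟩
  filter_upwards [hlim1.eventually (gt_mem_nhds (by norm_num : (0 : ℝ) < 1 / 2)),
    hlim2.eventually (gt_mem_nhds one_pos)] with k hk1 hk2
  have hev : Continuous (ev k) := map_continuous (ev k)
  have hleft : star (ev k (g * c)) * ev k (g * c) = 1 := by
    have h1 : ev k (star (g * c) * (g * c) - 1) = 0 := by
      rw [hstar, StarAlgHomClass.map_cfc (ev k) _ h (by fun_prop) hev hsa (hsa.map (ev k))]
      rcases subsingleton_or_nontrivial D with _ | _
      · exact Subsingleton.elim _ _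
      rw [cfc_congr (g := fun _ => (0 : ℝ)), cfc_const_zero]
      intro t ht
      have h2 : t - 1 ∈ spectrum ℝ (ev k h - 1) := by
        have := spectrum.sub_singleton_eq (ev k h) (1 : ℝ)
        rw [map_one] at this
        rw [← this]
        exact Set.sub_mem_sub ht rfl
      have h3 : |t - 1| < 1 / 2 := by
        rw [map_sub, map_one] at hk1
        exact (spectrum.norm_le_norm_of_mem h2).trans_lt hk1
      have h4 : 1 / 2 < t := by linarith [(abs_lt.1 h3).1]
      have h5 : φ t = (√t)⁻¹ := by simp only [φ, max_eq_left h4.le]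
      have h6 : 0 < √t := Real.sqrt_pos.2 (by linarith)
      have h7 : √t * √t = t := Real.mul_self_sqrt (by linarith)
      simp only [h5]
      field_simp
      nlinarith
    rwa [map_sub, map_mul, map_star, map_one, sub_eq_zero] at h1
  set x : D := ev k (g * c) with hx
  have hunit : IsUnit (x * star x) := by
    have h1 : ‖1 - x * star x‖ < 1 := by 
      rwa [map_sub, map_mul, map_star, map_one, norm_sub_rev] at hk2
    have h2 := (Units.oneSub _ h1).isUnit
    rwa [Units.val_oneSub, sub_sub_cancel] at h2
  have hidem : (x * star x) * (x * star x) = x * star x * 1 := by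
    rw [mul_assoc, ← mul_assoc (star x), hleft, one_mul, mul_one]
  exact Unitary.mem_iff.2 ⟨hleft, hunit.mul_left_cancel hidem⟩

end Corona

section Intertwining

variable {A B G : Type*} [NonUnitalCStarAlgebra A] [NonUnitalCStarAlgebra B] [Group G]

theorem norm_monoidHom_apply (Θ : G →* (B →⋆ₙₐ[ℂ] B)) (g : G) (b : B) : ‖Θ g b‖ = ‖b‖ := by
  refine le_antisymm (NonUnitalStarAlgHom.norm_apply_le (Θ g) b) ?_
  have h : Θ g⁻¹ (Θ g b) = b := by
    have : (Θ g⁻¹ * Θ g) b = b := by rw [← map_mul, inv_mul_cancel, map_one]; rfl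
    exact this
  calc ‖b‖ = ‖Θ g⁻¹ (Θ g b)‖ := by rw [h]
    _ ≤ ‖Θ g b‖ := NonUnitalStarAlgHom.norm_apply_le (Θ g⁻¹) _

/-- A point-norm Cauchy sequence of *-homomorphisms converges to a *-homomorphism. -/
theorem exists_nonUnitalStarAlgHom_tendsto (T : ℕ → A →⋆ₙₐ[ℂ] B)
    (hT : ∀ a, CauchySeq fun n => T n a) :
    ∃ ψ : A →⋆ₙₐ[ℂ] B, ∀ a, Tendsto (fun n => T n a) atTop (𝓝 (ψ a)) := by
  choose L hL using fun a => cauchySeq_tendsto_of_complete (hT a)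
  exact ⟨
    { toFun := L
      map_smul' := fun c a => tendsto_nhds_unique (hL (c • a))
        (((hL a).const_smul c).congr fun n => (map_smul (T n) c a).symm)
      map_zero' := tendsto_nhds_unique (hL 0)
        (tendsto_const_nhds.congr fun n => (map_zero (T n)).symm)
      map_add' := fun a b => tendsto_nhds_unique (hL (a + b))
        (((hL a).add (hL b)).congr fun n => (map_add (T n) a b).symm)
      map_mul' := fun a b => tendsto_nhds_unique (hL (a * b))
        (((hL a).mul (hL b)).congr fun n => (map_mul (T n) a b).symm)
      map_star' := fun a => tendsto_nhds_unique (hL (star a))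
        ((hL a).star.congr fun n => (map_star (T n) a).symm) }, hL⟩

/-- One-sided approximate intertwining: if a group acting on `B` can almost fix finite subsets of
`ι(A)` while moving `ι(A)` close to given finite subsets of `B`, then a point-norm limit of
composites of `ι` with the action is an isomorphism. -/
theorem exists_starAlgEquiv_tendsto [TopologicalSpace.SeparableSpace A]
    [TopologicalSpace.SeparableSpace B] (Θ : G →* (B →⋆ₙₐ[ℂ] B)) (ι : A →⋆ₙₐ[ℂ] B)
    (hι : Function.Injective ι)
    (H : ∀ (F : Finset A) (S : Finset B) (ε : ℝ), 0 < ε → ∃ v : G,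
      (∀ a ∈ F, ‖Θ v (ι a) - ι a‖ < ε) ∧ ∀ b ∈ S, ∃ a, ‖b - Θ v (ι a)‖ < ε) :
    ∃ (ψ : A ≃⋆ₐ[ℂ] B) (w : ℕ → G), ∀ a, Tendsto (fun n => Θ (w n) (ι a)) atTop (𝓝 (ψ a)) := by
  classical
  have hmul : ∀ (g h : G) (b : B), Θ (g * h) b = Θ g (Θ h b) := fun g h b => by
    rw [map_mul]; rfl
  have hnorm := norm_monoidHom_apply Θ
  have hιn := NonUnitalStarAlgHom.norm_map ι hι
  let α := TopologicalSpace.denseSeq A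
  let β := TopologicalSpace.denseSeq B
  have step : ∀ (n : ℕ) (s : G × Finset A), ∃ s' : G × Finset A, s.2 ⊆ s'.2 ∧ α n ∈ s'.2 ∧
      (∀ a ∈ s.2, ‖Θ s'.1 (ι a) - Θ s.1 (ι a)‖ ≤ (1 / 2) ^ n) ∧
      ∀ j ≤ n, ∃ a ∈ s'.2, ‖β j - Θ s'.1 (ι a)‖ ≤ (1 / 2) ^ n := by
    rintro n ⟨w, F⟩
    obtain ⟨v, hvF, hvS⟩ := H F ((Finset.range (n + 1)).image fun j => Θ w⁻¹ (β j))
      ((1 / 2) ^ n) (by positivity)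
    have hvS' : ∀ j, ∃ a, j ≤ n → ‖Θ w⁻¹ (β j) - Θ v (ι a)‖ < (1 / 2) ^ n := fun j => by
      by_cases hj : j ≤ n
      · obtain ⟨a, ha⟩ := hvS _ (Finset.mem_image_of_mem _ (Finset.mem_range_succ_iff.2 hj))
        exact ⟨a, fun _ => ha⟩
      · exact ⟨0, fun h => absurd h hj⟩
    choose γ hγ using hvS'
    refine ⟨(w * v, insert (α n) (F ∪ (Finset.range (n + 1)).image γ)), ?_, ?_, ?_, ?_⟩
    · exact fun a ha => Finset.mem_insert_of_mem (Finset.mem_union_left _ ha)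
    · exact Finset.mem_insert_self _ _
    · intro a ha
      simp only [hmul]
      rw [← map_sub, hnorm]
      exact (hvF a ha).le
    · intro j hj
      refine ⟨γ j, Finset.mem_insert_of_mem (Finset.mem_union_right _
        (Finset.mem_image_of_mem _ (Finset.mem_range_succ_iff.2 hj))), ?_⟩
      have h1 : β j = Θ w (Θ w⁻¹ (β j)) := by rw [← hmul, mul_inv_cancel, map_one]; rfl
      rw [hmul, h1, ← map_sub, hnorm]
      exact (hγ j hj).le
  choose next hsub hα hclose hβ using step
  obtain ⟨s, hs⟩ : ∃ s : ℕ → G × Finset A, ∀ n, s (n + 1) = next n (s n) :=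
    ⟨fun n => Nat.rec (1, ∅) next n, fun _ => rfl⟩
  obtain ⟨T, hT⟩ : ∃ T : ℕ → A →⋆ₙₐ[ℂ] B, ∀ n a, T n a = Θ (s n).1 (ι a) :=
    ⟨fun n => (Θ (s n).1).comp ι, fun _ _ => rfl⟩
  have hTn : ∀ n a, ‖T n a‖ = ‖a‖ := fun n a => by rw [hT, hnorm, hιn]
  have hmono : Monotone fun n => (s n).2 := monotone_nat_of_le_succ fun n => by
    simpa only [hs] using hsub n (s n)
  have hgeom : ∀ (m : ℕ) (a : A), a ∈ (s m).2 → ∀ k,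
      dist (T (k + m) a) (T (k + 1 + m) a) ≤ (1 / 2) ^ m * (1 / 2) ^ k := by
    intro m a ha k
    have := hclose (k + m) (s (k + m)) a (hmono (Nat.le_add_left m k) ha)
    rw [dist_comm, dist_eq_norm, ← pow_add, add_comm m k, add_right_comm, hT, hT, hs]
    exact this
  have hcauchyα : ∀ i, CauchySeq fun n => T n (α i) := fun i => by
    rw [← cauchySeq_shift (i + 1)]
    exact cauchySeq_of_le_geometric _ _ (by norm_num) (hgeom (i + 1) (α i) (by rw [hs]; exact hα i (s i)))
  have hcauchy : ∀ a, CauchySeq fun n => T n a := by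
    intro a
    rw [Metric.cauchySeq_iff']
    intro ε hε
    obtain ⟨i, hi⟩ := (TopologicalSpace.denseRange_denseSeq A).exists_dist_lt a
      (by positivity : 0 < ε / 3)
    obtain ⟨N, hN⟩ := Metric.cauchySeq_iff'.1 (hcauchyα i) (ε / 3) (by positivity)
    refine ⟨N, fun n hn => ?_⟩
    have h1 : ∀ k, dist (T k a) (T k (α i)) < ε / 3 := fun k => by
      rw [dist_eq_norm, ← map_sub, hTn, ← dist_eq_norm]
      exact hi
    have h2 := h1 n
    have h3 := h1 N
    rw [dist_comm] at h3
    linarith [dist_triangle4 (T n a) (T n (α i)) (T N (α i)) (T N a), hN n hn]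
  obtain ⟨ψ, hL⟩ := exists_nonUnitalStarAlgHom_tendsto T hcauchy
  have hψn : ∀ a, ‖ψ a‖ = ‖a‖ := fun a =>
    tendsto_nhds_unique (hL a).norm (tendsto_const_nhds.congr fun n => (hTn n a).symm)
  have hψ : Isometry ψ := AddMonoidHomClass.isometry_of_norm ψ hψn
  have hdense : DenseRange ψ := by
    refine Metric.denseRange_iff.2 fun b ε hε => ?_
    obtain ⟨j, hj⟩ := (TopologicalSpace.denseRange_denseSeq B).exists_dist_lt b
      (by positivity : 0 < ε / 2)
    obtain ⟨N, hN⟩ := exists_pow_lt_of_lt_one (by positivity : 0 < ε / 4)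
      (by norm_num : (1 / 2 : ℝ) < 1)
    set n := max N j with hn
    have hnN : ((1 : ℝ) / 2) ^ n < ε / 4 :=
      (pow_le_pow_of_le_one (by norm_num) (by norm_num) (le_max_left _ _)).trans_lt hN
    obtain ⟨a, ha, hab⟩ := hβ n (s n) j (le_max_right _ _)
    rw [← hs] at ha hab
    refine ⟨a, ?_⟩
    have h1 : dist (T (0 + (n + 1)) a) (ψ a) ≤ (1 / 2) ^ (n + 1) / (1 - 1 / 2) :=
      dist_le_of_le_geometric_of_tendsto₀ (f := fun k => T (k + (n + 1)) a) _ _ (by norm_num) (hgeom (n + 1) a ha)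
        ((hL a).comp (tendsto_add_atTop_nat (n + 1)))
    have h2 : dist (β j) (T (0 + (n + 1)) a) ≤ (1 / 2) ^ n := by
      rw [dist_eq_norm, zero_add, hT]
      exact hab
    have h3 : ((1 : ℝ) / 2) ^ (n + 1) / (1 - 1 / 2) = (1 / 2) ^ n := by
      rw [pow_succ]; norm_num
    rw [h3] at h1
    have hj' : dist b (β j) < ε / 2 := hj
    linarith [dist_triangle4 b (β j) (T (0 + (n + 1)) a) (ψ a)]
  have hsurj : Function.Surjective ψ := by
    rw [← Set.range_eq_univ, ← hψ.isClosedEmbedding.isClosed_range.closure_eq]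
    exact hdense.closure_range
  exact ⟨StarAlgEquiv.ofBijective ψ ⟨hψ.injective, hsurj⟩, fun n => (s n).1, fun a => (hL a).congr fun n => hT n a⟩

end Intertwining

section Conjugation

variable {B : Type*} [NonUnitalCStarAlgebra B]

theorem inr_snd_conj (x y : Unitization ℂ B) (b : B) :
    (((x * (b : Unitization ℂ B) * y).snd : B) : Unitization ℂ B) = x * (b : Unitization ℂ B) * y :=
  Unitization.ext (by simp) (by simp)

/-- Conjugation of `B` by a unitary of its unitization. -/
def unitizationConjHom (u : unitary (Unitization ℂ B)) : B →⋆ₙₐ[ℂ] B where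
  toFun b := ((u : Unitization ℂ B) * (b : Unitization ℂ B) * star (u : Unitization ℂ B)).snd
  map_smul' c b := by
    apply Unitization.inr_injective (R := ℂ)
    rw [inr_snd_conj]
    simp only [MonoidHom.id_apply, Unitization.inr_smul]
    rw [inr_snd_conj, mul_smul_comm, smul_mul_assoc]
  map_zero' := by simp
  map_add' a b := by
    apply Unitization.inr_injective (R := ℂ)
    rw [inr_snd_conj, Unitization.inr_add, Unitization.inr_add, inr_snd_conj, inr_snd_conj,
      mul_add, add_mul]
  map_mul' a b := by
    apply Unitization.inr_injective (R := ℂ)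
    rw [inr_snd_conj, Unitization.inr_mul, Unitization.inr_mul, inr_snd_conj, inr_snd_conj]
    simp only [mul_assoc]
    rw [← mul_assoc (star (u : Unitization ℂ B)) u, Unitary.coe_star_mul_self, one_mul]
  map_star' a := by
    apply Unitization.inr_injective (R := ℂ)
    rw [inr_snd_conj, Unitization.inr_star, Unitization.inr_star, inr_snd_conj, star_mul, star_mul,
      star_star, mul_assoc]

theorem coe_unitizationConjHom (u : unitary (Unitization ℂ B)) (b : B) :
    (unitizationConjHom u b : Unitization ℂ B) =
      (u : Unitization ℂ B) * (b : Unitization ℂ B) * star (u : Unitization ℂ B) :=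
  inr_snd_conj _ _ b

/-- The action of the unitary group of the unitization of `B` on `B` by conjugation. -/
def unitizationConj : unitary (Unitization ℂ B) →* (B →⋆ₙₐ[ℂ] B) where
  toFun := unitizationConjHom
  map_one' := by
    ext b
    apply Unitization.inr_injective (R := ℂ)
    rw [coe_unitizationConjHom]
    simp
  map_mul' u v := by
    ext b
    apply Unitization.inr_injective (R := ℂ)
    change _ = ((unitizationConjHom u (unitizationConjHom v b) : B) : Unitization ℂ B)
    rw [coe_unitizationConjHom, coe_unitizationConjHom, coe_unitizationConjHom, Submonoid.coe_mul,
      star_mul]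
    simp only [mul_assoc]

theorem coe_unitizationConj (u : unitary (Unitization ℂ B)) (b : B) :
    (unitizationConj u b : Unitization ℂ B) =
      (u : Unitization ℂ B) * (b : Unitization ℂ B) * star (u : Unitization ℂ B) :=
  coe_unitizationConjHom u b

theorem approxUnitaryEquiv_of_tendsto_unitizationConj {A : Type*} {φ ψ : A → B}
    (w : ℕ → unitary (Unitization ℂ B))
    (h : ∀ a, Tendsto (fun n => unitizationConj (w n) (ψ a)) atTop (𝓝 (φ a))) :
    ApproxUnitaryEquiv φ ψ := by
  let ρ : Unitization ℂ B →⋆ₐ[ℂ] 𝓜(ℂ, B) :=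
    Unitization.starLift (DoubleCentralizer.coeHom (𝕜 := ℂ) (A := B))
  have hρ : ∀ b : B, ρ (b : Unitization ℂ B) = (b : 𝓜(ℂ, B)) := fun b =>
    DFunLike.congr_fun (Unitization.starLift.symm_apply_apply
      (DoubleCentralizer.coeHom (𝕜 := ℂ) (A := B))) b
  refine ⟨fun n => ρ (w n), fun n => Unitary.map_mem ρ (w n).2, fun a => ?_⟩
  refine squeeze_zero (fun n => norm_nonneg _) (fun n => ?_)
    (tendsto_iff_norm_sub_tendsto_zero.1 (h a))
  have hw : star (w n : Unitization ℂ B) * w n = 1 := Unitary.coe_star_mul_self (w n)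
  have h1 : star (ρ (w n)) * (φ a : 𝓜(ℂ, B)) * ρ (w n) - (ψ a : 𝓜(ℂ, B)) =
      ρ (star (w n : Unitization ℂ B) *
        ((φ a - unitizationConj (w n) (ψ a) : B) : Unitization ℂ B) * w n) := by
    rw [← hρ, ← hρ, ← map_star, ← map_mul, ← map_mul, ← map_sub, Unitization.inr_sub,
      coe_unitizationConj, mul_sub, sub_mul]
    congr 2
    rw [← mul_assoc, ← mul_assoc, hw, one_mul, mul_assoc, hw, mul_one]
  rw [h1]
  calc _ ≤ ‖star (w n : Unitization ℂ B) *
        ((φ a - unitizationConj (w n) (ψ a) : B) : Unitization ℂ B) * w n‖ :=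
        NonUnitalStarAlgHom.norm_apply_le ρ _
    _ = ‖((φ a - unitizationConj (w n) (ψ a) : B) : Unitization ℂ B)‖ := by
        rw [CStarRing.norm_mul_coe_unitary, ← Unitary.coe_star, CStarRing.norm_coe_unitary_mul]
    _ = _ := by rw [Unitization.norm_inr, norm_sub_rev]

end Conjugation

section SequenceAlgebra

open BoundedContinuousFunction

/-- The bounded sequences over a unital C*-algebra, as a unital C*-algebra carrying the quotient map
onto the sequence algebra and the evaluations at the indices. -/
theorem IsSeqCorona.exists_cstarAlgebra {D : Type u} {Q : Type v} [CStarAlgebra D]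
    [CStarAlgebra Q] (hQ : IsSeqCorona D Q) (hone : hQ.incl 1 = 1) :
    ∃ (C : Type u) (_ : CStarAlgebra C) (p : C →⋆ₐ[ℂ] Q) (ev : ℕ → C →⋆ₐ[ℂ] D),
      Function.Surjective p ∧ (∀ g, p g = 0 → Tendsto (fun k => ‖ev k g‖) atTop (𝓝 0)) ∧
      ∀ f : boundedSeqs D, ∃ c, (∀ k, ev k c = (f : ℕ → D) k) ∧ p c = hQ.q f := by
  let toSeq : (ℕ →ᵇ D) → boundedSeqs D := fun g => ⟨g, ‖g‖, g.norm_coe_le_norm⟩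
  let ofSeq : boundedSeqs D → (ℕ →ᵇ D) := fun f =>
    ofNormedAddCommGroupDiscrete f f.2.choose f.2.choose_spec
  have hof : ∀ f, toSeq (ofSeq f) = f := fun _ => rfl
  let p : (ℕ →ᵇ D) →⋆ₐ[ℂ] Q :=
    { toFun := fun g => hQ.q (toSeq g)
      map_one' := hone
      map_mul' := fun f g => map_mul hQ.q (toSeq f) (toSeq g)
      map_zero' := map_zero hQ.q
      map_add' := fun f g => map_add hQ.q (toSeq f) (toSeq g)
      commutes' := fun c => by
        have h : toSeq (algebraMap ℂ (ℕ →ᵇ D) c) = c • constSeq 1 :=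
          Subtype.ext <| funext fun _ => Algebra.algebraMap_eq_smul_one c
        rw [h, map_smul, Algebra.algebraMap_eq_smul_one, ← hone]
        rfl
      map_star' := fun f => map_star hQ.q (toSeq f) }
  let ev : ℕ → (ℕ →ᵇ D) →⋆ₐ[ℂ] D := fun k =>
    { toFun := fun g => g k
      map_one' := rfl
      map_mul' := fun _ _ => rfl
      map_zero' := rfl
      map_add' := fun _ _ => rfl
      commutes' := fun _ => rfl
      map_star' := fun _ => rfl }
  refine ⟨ℕ →ᵇ D, inferInstance, p, ev, fun x => ?_, fun g hg => (hQ.ker_iff (toSeq g)).1 hg,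
    fun f => ⟨ofSeq f, fun _ => rfl, congrArg hQ.q (hof f)⟩⟩
  obtain ⟨f, rfl⟩ := hQ.surjective x
  exact ⟨ofSeq f, congrArg hQ.q (hof f)⟩

end SequenceAlgebra

/-- Unitaries in the sequence algebra asymptotically commuting with `ι(A)` and conjugating `B` into
the sequences in `ι(A)` yield unitaries in `B⁺` doing so approximately on finite sets. -/
theorem exists_unitary_of_seqCorona {A : Type u} {B : Type u} {QB : Type v}
    [NonUnitalCStarAlgebra A] [NonUnitalCStarAlgebra B] [CStarAlgebra QB]
    (ι : A →⋆ₙₐ[ℂ] B)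
    (hQ : IsSeqCorona (Unitization ℂ B) QB) (hQone : hQ.incl 1 = 1)
    (v : ℕ → QB) (hv : ∀ n, v n ∈ unitary QB)
    (hcomm : ∀ a : A, Tendsto (fun n =>
        ‖v n * hQ.incl (ι a : Unitization ℂ B) - hQ.incl (ι a : Unitization ℂ B) * v n‖)
      atTop (𝓝 (0 : ℝ)))
    (hdist : ∀ b : B, Tendsto (fun n =>
        Metric.infDist (star (v n) * hQ.incl (b : Unitization ℂ B) * v n)
          {x : QB | ∃ f : boundedSeqs (Unitization ℂ B),
            (∀ k, ∃ a : A, (f : ℕ → Unitization ℂ B) k = (ι a : Unitization ℂ B)) ∧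
            hQ.q f = x})
      atTop (𝓝 (0 : ℝ)))
    (F : Finset A) (S : Finset B) (ε : ℝ) (hε : 0 < ε) :
    ∃ u : unitary (Unitization ℂ B),
      (∀ a ∈ F, ‖unitizationConj u (ι a) - ι a‖ < ε) ∧
      ∀ b ∈ S, ∃ a, ‖b - unitizationConj u (ι a)‖ < ε := by
  obtain ⟨C, _, p, ev, hsurj, hker, hseq⟩ := hQ.exists_cstarAlgebra hQone
  have h1 : ∀ᶠ n in atTop, ∀ a ∈ F,
      ‖v n * hQ.incl (ι a : Unitization ℂ B) - hQ.incl (ι a : Unitization ℂ B) * v n‖ < ε :=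
    (Filter.eventually_all_finset F).2 fun a _ => (hcomm a).eventually (gt_mem_nhds hε)
  have h2 := (Filter.eventually_all_finset S).2 fun b _ =>
    (hdist b).eventually (gt_mem_nhds hε)
  obtain ⟨n, hn1, hn2⟩ := (h1.and h2).exists
  obtain ⟨x, hx, hxu⟩ := exists_eventually_mem_unitary_lift hsurj hker (hv n)
  have h3 : ∀ᶠ k in atTop, ∀ a ∈ F,
      ‖ev k x * (ι a : Unitization ℂ B) - (ι a : Unitization ℂ B) * ev k x‖ < ε := by
    refine (Filter.eventually_all_finset F).2 fun a ha => ?_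
    obtain ⟨c, hc, hpc⟩ := hseq (constSeq (ι a : Unitization ℂ B))
    have h4 : ‖p (x * c - c * x)‖ < ε := by
      rw [map_sub, map_mul, map_mul, hx, hpc]
      exact hn1 a ha
    filter_upwards [eventually_norm_lt_of_norm_map_lt hker h4] with k hk
    rw [map_sub, map_mul, map_mul, hc] at hk
    exact hk
  have h5 : ∀ᶠ k in atTop, ∀ b ∈ S, ∃ a,
      ‖star (ev k x) * (b : Unitization ℂ B) * ev k x - (ι a : Unitization ℂ B)‖ < ε := by
    refine (Filter.eventually_all_finset S).2 fun b hb => ?_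
    obtain ⟨y, ⟨f, hf, rfl⟩, hy⟩ := (Metric.infDist_lt_iff
      (by exact ⟨0, 0, fun _ => ⟨0, by simp⟩, map_zero hQ.q⟩)).1 (hn2 b hb)
    obtain ⟨c, hc, hpc⟩ := hseq (constSeq (b : Unitization ℂ B))
    obtain ⟨d, hd, hpd⟩ := hseq f
    have h6 : ‖p (star x * c * x - d)‖ < ε := by
      rw [map_sub, map_mul, map_mul, map_star, hx, hpc, hpd, ← dist_eq_norm]
      exact hy
    filter_upwards [eventually_norm_lt_of_norm_map_lt hker h6] with k hk
    obtain ⟨a, ha⟩ := hf k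
    rw [map_sub, map_mul, map_mul, map_star, hc, hd, ha] at hk
    exact ⟨a, hk⟩
  obtain ⟨k, hku, hk3, hk5⟩ := (hxu.and (h3.and h5)).exists
  refine ⟨⟨ev k x, hku⟩, fun a ha => ?_, fun b hb => ?_⟩
  · rw [← Unitization.norm_inr (𝕜 := ℂ), Unitization.inr_sub, coe_unitizationConj]
    have h7 : ev k x * (ι a : Unitization ℂ B) * star (ev k x) - (ι a : Unitization ℂ B) =
        (ev k x * (ι a : Unitization ℂ B) - (ι a : Unitization ℂ B) * ev k x) *
          star (ev k x) := by
      rw [sub_mul, mul_assoc (ι a : Unitization ℂ B), Unitary.mul_star_self_of_mem hku, mul_one]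
    change ‖ev k x * (ι a : Unitization ℂ B) * star (ev k x) - (ι a : Unitization ℂ B)‖ < ε
    rw [h7, CStarRing.norm_mul_mem_unitary _ (Unitary.star_mem hku)]
    exact hk3 a ha
  · obtain ⟨a, ha⟩ := hk5 b hb
    refine ⟨a, ?_⟩
    rw [← Unitization.norm_inr (𝕜 := ℂ), Unitization.inr_sub, coe_unitizationConj]
    have h8 : (b : Unitization ℂ B) - ev k x * (ι a : Unitization ℂ B) * star (ev k x) =
        ev k x * (star (ev k x) * (b : Unitization ℂ B) * ev k x - (ι a : Unitization ℂ B)) *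
          star (ev k x) := by
      have h9 := Unitary.mul_star_self_of_mem hku
      rw [mul_sub, sub_mul]
      congr 1
      rw [mul_assoc _ _ (star (ev k x)), mul_assoc _ (ev k x) (star (ev k x)), h9, mul_one,
        ← mul_assoc, h9, one_mul]
    change ‖(b : Unitization ℂ B) - ev k x * (ι a : Unitization ℂ B) * star (ev k x)‖ < ε
    rw [h8, CStarRing.norm_mul_mem_unitary _ (Unitary.star_mem hku),
      CStarRing.norm_mem_unitary_mul _ hku]
    exact ha

/-- Let `ι : A → B` be an embedding of separable C*-algebras, and realize `Q(B⁺)` (the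
sequence algebra of the unitization of `B`) as `QB`.  If there is a sequence of unitaries
`vₙ ∈ Q(B⁺)` asymptotically commuting with `ι(A)` and asymptotically conjugating `B` into
`Q(ι(A))`, then there is an isomorphism `ψ : A → B` approximately unitarily equivalent
to `ι`. -/
theorem stmt_12 {A : Type u} {B : Type u} {QB : Type v}
    [NonUnitalCStarAlgebra A] [NonUnitalCStarAlgebra B] [CStarAlgebra QB]
    [TopologicalSpace.SeparableSpace A] [TopologicalSpace.SeparableSpace B]
    (ι : A →⋆ₙₐ[ℂ] B) (hι : Function.Injective ι)
    (hQ : IsSeqCorona (Unitization ℂ B) QB) (hQone : hQ.incl 1 = 1)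
    (v : ℕ → QB) (hv : ∀ n, v n ∈ unitary QB)
    (hcomm : ∀ a : A, Tendsto (fun n =>
        ‖v n * hQ.incl (ι a : Unitization ℂ B) - hQ.incl (ι a : Unitization ℂ B) * v n‖)
      atTop (𝓝 (0 : ℝ)))
    (hdist : ∀ b : B, Tendsto (fun n =>
        Metric.infDist (star (v n) * hQ.incl (b : Unitization ℂ B) * v n)
          {x : QB | ∃ f : boundedSeqs (Unitization ℂ B),
            (∀ k, ∃ a : A, (f : ℕ → Unitization ℂ B) k = (ι a : Unitization ℂ B)) ∧
            hQ.q f = x})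
      atTop (𝓝 (0 : ℝ))) :
    ∃ ψ : A ≃⋆ₐ[ℂ] B, ApproxUnitaryEquiv (⇑ψ) (⇑ι) := by
  obtain ⟨ψ, w, hw⟩ := exists_starAlgEquiv_tendsto unitizationConj ι hι
    (exists_unitary_of_seqCorona ι hQ hQone v hv hcomm hdist)
  exact ⟨ψ, approxUnitaryEquiv_of_tendsto_unitizationConj w hw⟩
end
end
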